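/- arXiv:1706.00475 — 3 statements merged into one kernel-verified Lean document; each statement's English description precedes it below -/
import Mathlib

section
/- Let Λ be an artin algebra and T a tilting Λ-module with B = End_Λ(T)^op. Then |gldim B − gldim Λ| ≤ 1 (interpreting the inequality as: each global dimension is at most the other plus 1, including infinite values simultaneously). -/
open Function LinearMap

section Prelim

variable (Λ : Type) [Ring Λ]

/-- A module that is both projective and injective. -/
def IsProjInj (M : Type) [AddCommGroup M] [Module Λ M] : Prop :=
  Module.Projective Λ M ∧ Module.Injective Λ M

/-- `X` is generated by the projective-injective modules: it is a quotient of a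
finitely generated projective-injective module (equivalently, of a finite direct sum of
copies of `Q̃`). -/
def GenByProjInj (X : Type) [AddCommGroup X] [Module Λ X] : Prop :=
  ∃ Q : ModuleCat.{0} Λ, Module.Finite Λ Q ∧ IsProjInj Λ Q ∧
    ∃ f : Q →ₗ[Λ] X, Surjective f

/-- `X` is cogenerated by the projective-injective modules: it embeds into a
finitely generated projective-injective module. -/
def CogenByProjInj (X : Type) [AddCommGroup X] [Module Λ X] : Prop :=
  ∃ Q : ModuleCat.{0} Λ, Module.Finite Λ Q ∧ IsProjInj Λ Q ∧
    ∃ f : X →ₗ[Λ] Q, Injective f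

/-- Membership in `C_Λ = Gen(Q̃) ∩ Cogen(Q̃)`. -/
def MemC (X : Type) [AddCommGroup X] [Module Λ X] : Prop :=
  GenByProjInj Λ X ∧ CogenByProjInj Λ X

/-- `pdLEcat Λ n X` : `X` has projective dimension at most `n`. -/
def pdLEcat : ℕ → ModuleCat.{0} Λ → Prop
  | 0, X => Module.Projective Λ X
  | n+1, X => ∃ (P : ModuleCat.{0} Λ) (g : P →ₗ[Λ] X),
      Module.Projective Λ P ∧ Module.Finite Λ P ∧ Surjective g ∧
      pdLEcat n (ModuleCat.of Λ (↥(LinearMap.ker g)))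

/-- Projective dimension at most `n`, for a bare module. -/
def pdLE (n : ℕ) (X : Type) [AddCommGroup X] [Module Λ X] : Prop :=
  pdLEcat Λ n (ModuleCat.of Λ X)

/-- `idLEcat Λ n X` : `X` has injective dimension at most `n`. -/
def idLEcat : ℕ → ModuleCat.{0} Λ → Prop
  | 0, X => Module.Injective Λ X
  | n+1, X => ∃ (I : ModuleCat.{0} Λ) (f : X →ₗ[Λ] I),
      Module.Injective Λ I ∧ Injective f ∧
      idLEcat n (ModuleCat.of Λ (↥I ⧸ LinearMap.range f))

/-- Injective dimension at most `n`, for a bare module. -/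
def idLE (n : ℕ) (X : Type) [AddCommGroup X] [Module Λ X] : Prop :=
  idLEcat Λ n (ModuleCat.of Λ X)

/-- Global dimension at most `d` (on finitely generated modules). -/
def GlobalDimLE (d : ℕ) : Prop :=
  ∀ X : ModuleCat.{0} Λ, Module.Finite Λ X → pdLEcat Λ d X

/-- Global dimension exactly `d`. -/
def GlobalDimEq (d : ℕ) : Prop :=
  GlobalDimLE Λ d ∧ ∀ m, GlobalDimLE Λ m → d ≤ m

/-- `Ext¹_Λ(Y, X) = 0`, expressed by the splitting of all short exact sequences
`0 → X → E → Y → 0`. -/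
def Ext1Vanish (Y X : Type) [AddCommGroup Y] [Module Λ Y]
    [AddCommGroup X] [Module Λ X] : Prop :=
  ∀ (E : ModuleCat.{0} Λ) (f : X →ₗ[Λ] E) (g : E →ₗ[Λ] Y),
    Injective f → Surjective g → LinearMap.range f = LinearMap.ker g →
    ∃ r : E →ₗ[Λ] X, r ∘ₗ f = LinearMap.id

/-- `M` belongs to `add T`: `M` is a direct summand of a finite direct sum of copies of `T`. -/
def InAddOf (T M : Type) [AddCommGroup T] [Module Λ T]
    [AddCommGroup M] [Module Λ M] : Prop :=
  ∃ (m : ℕ) (p : (Fin m → T) →ₗ[Λ] M) (s : M →ₗ[Λ] (Fin m → T)),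
    p ∘ₗ s = LinearMap.id

/-- A (classical) tilting module. -/
def IsTilting (T : Type) [AddCommGroup T] [Module Λ T] : Prop :=
  pdLE Λ 1 T ∧ Ext1Vanish Λ T T ∧
  ∃ (T0 T1 : ModuleCat.{0} Λ) (f : Λ →ₗ[Λ] T0) (g : T0 →ₗ[Λ] T1),
    InAddOf Λ T T0 ∧ InAddOf Λ T T1 ∧ Injective f ∧ Surjective g ∧
    LinearMap.range f = LinearMap.ker g

/-- A (classical) cotilting module. -/
def IsCotilting (T : Type) [AddCommGroup T] [Module Λ T] : Prop :=
  idLE Λ 1 T ∧ Ext1Vanish Λ T T ∧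
  ∀ (I : ModuleCat.{0} Λ), Module.Finite Λ I → Module.Injective Λ I →
    ∃ (C0 C1 : ModuleCat.{0} Λ) (u : C0 →ₗ[Λ] C1) (v : C1 →ₗ[Λ] I),
      InAddOf Λ T C0 ∧ InAddOf Λ T C1 ∧ Injective u ∧ Surjective v ∧
      LinearMap.range u = LinearMap.ker v

/-- Dominant dimension at least `2`: there is an exact sequence `0 → Λ → Q₀ → Q₁`
with `Q₀, Q₁` projective-injective. -/
def DomdimGE2 : Prop :=
  ∃ (Q0 Q1 : ModuleCat.{0} Λ) (f : Λ →ₗ[Λ] Q0) (g : Q0 →ₗ[Λ] Q1),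
    Module.Finite Λ Q0 ∧ IsProjInj Λ Q0 ∧ Module.Finite Λ Q1 ∧ IsProjInj Λ Q1 ∧
    Injective f ∧ LinearMap.range f = LinearMap.ker g

/-- An indecomposable (nonzero) module: the only idempotent endomorphisms are `0` and `id`. -/
def Indecomposable (M : Type) [AddCommGroup M] [Module Λ M] : Prop :=
  (∃ x : M, x ≠ 0) ∧ ∀ e : M →ₗ[Λ] M, e ∘ₗ e = e → e = 0 ∨ e = LinearMap.id

/-- A right minimal morphism. -/
def RightMinimal {B C : Type} [AddCommGroup B] [Module Λ B] [AddCommGroup C] [Module Λ C]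
    (f : B →ₗ[Λ] C) : Prop :=
  ∀ g : B →ₗ[Λ] B, f ∘ₗ g = f → Bijective g

/-- A left minimal morphism. -/
def LeftMinimal {A B : Type} [AddCommGroup A] [Module Λ A] [AddCommGroup B] [Module Λ B]
    (f : A →ₗ[Λ] B) : Prop :=
  ∀ g : B →ₗ[Λ] B, g ∘ₗ f = f → Bijective g

/-- `f : P → X` is a projective cover: `P` is projective, `f` is surjective and its kernel
is superfluous. -/
def IsProjCover {P X : Type} [AddCommGroup P] [Module Λ P] [AddCommGroup X] [Module Λ X]
    (f : P →ₗ[Λ] X) : Prop :=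
  Module.Projective Λ P ∧ Surjective f ∧
    ∀ N : Submodule Λ P, N ⊔ LinearMap.ker f = ⊤ → N = ⊤

/-- `f : X → I` is an injective envelope: `I` is injective, `f` is injective and its image is
essential. -/
def IsInjEnv {X I : Type} [AddCommGroup X] [Module Λ X] [AddCommGroup I] [Module Λ I]
    (f : X →ₗ[Λ] I) : Prop :=
  Module.Injective Λ I ∧ Injective f ∧
    ∀ N : Submodule Λ I, N ⊓ LinearMap.range f = ⊥ → N = ⊥

/-- An essential submodule. -/
def IsEssentialSub {M : Type} [AddCommGroup M] [Module Λ M] (N : Submodule Λ M) : Prop :=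
  ∀ N' : Submodule Λ M, N ⊓ N' = ⊥ → N' = ⊥

/-- A uniserial module: submodules are totally ordered by inclusion. -/
def Uniserial (M : Type) [AddCommGroup M] [Module Λ M] : Prop :=
  ∀ N₁ N₂ : Submodule Λ M, N₁ ≤ N₂ ∨ N₂ ≤ N₁

/-- The radical of a module: the intersection of its maximal submodules. -/
def radSub (M : Type) [AddCommGroup M] [Module Λ M] : Submodule Λ M :=
  sInf {N : Submodule Λ M | IsCoatom N}

/-- An almost split (Auslander-Reiten) sequence `0 → A → E → C → 0`. -/
def IsAlmostSplitSeq {A E C : Type} [AddCommGroup A] [Module Λ A]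
    [AddCommGroup E] [Module Λ E] [AddCommGroup C] [Module Λ C]
    (f : A →ₗ[Λ] E) (g : E →ₗ[Λ] C) : Prop :=
  Injective f ∧ Surjective g ∧ LinearMap.range f = LinearMap.ker g ∧
  (¬∃ r : E →ₗ[Λ] A, r ∘ₗ f = LinearMap.id) ∧
  Indecomposable Λ A ∧ Indecomposable Λ C ∧
  ∀ (Z : ModuleCat.{0} Λ) (h : Z →ₗ[Λ] C), Module.Finite Λ Z →
    (¬∃ s : C →ₗ[Λ] Z, h ∘ₗ s = LinearMap.id) → ∃ l : (Z →ₗ[Λ] E), g ∘ₗ l = h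

/-- `N` is the Auslander-Reiten translate `τ M` of `M`: writing `M ≅ P ⊕ (⊕ᵢ Cᵢ)` with `P`
projective and `Cᵢ` indecomposable ends of almost split sequences `0 → Aᵢ → Eᵢ → Cᵢ → 0`,
we have `N ≅ ⊕ᵢ Aᵢ`. -/
def IsTauOf (N M : Type) [AddCommGroup N] [Module Λ N] [AddCommGroup M] [Module Λ M] : Prop :=
  ∃ (r : ℕ) (P : ModuleCat.{0} Λ) (A E C : Fin r → ModuleCat.{0} Λ)
    (f : ∀ i, (A i : Type) →ₗ[Λ] (E i : Type)) (g : ∀ i, (E i : Type) →ₗ[Λ] (C i : Type)),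
    Module.Projective Λ P ∧ (∀ i, IsAlmostSplitSeq Λ (f i) (g i)) ∧
    Nonempty (M ≃ₗ[Λ] (Prod (P : Type) ((i : Fin r) → (C i : Type)))) ∧
    Nonempty (N ≃ₗ[Λ] (∀ i, (A i : Type)))

end Prelim

section HomModule

variable {R : Type} [Ring R] {T M : Type} [AddCommGroup T] [Module R T]
  [AddCommGroup M] [Module R M]

/-- `Hom_R(T, M)` as a left module over `B = End_R(T)ᵒᵖ`, via precomposition. -/
instance instSMulHomEndOp : SMul (Module.End R T)ᵐᵒᵖ (T →ₗ[R] M) :=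
  ⟨fun b f => f ∘ₗ b.unop⟩

lemma endOp_smul_def (b : (Module.End R T)ᵐᵒᵖ) (f : T →ₗ[R] M) :
    b • f = f ∘ₗ b.unop := rfl

instance instMulActionHomEndOp : MulAction (Module.End R T)ᵐᵒᵖ (T →ₗ[R] M) where
  one_smul f := by ext x; rfl
  mul_smul b c f := by ext x; rfl

instance instDistribMulActionHomEndOp :
    DistribMulAction (Module.End R T)ᵐᵒᵖ (T →ₗ[R] M) where
  smul_zero b := by ext x; rfl
  smul_add b f g := by ext x; rfl

instance instModuleHomEndOp : Module (Module.End R T)ᵐᵒᵖ (T →ₗ[R] M) where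
  add_smul b c f := by ext x; simp [endOp_smul_def]
  zero_smul f := by ext x; simp [endOp_smul_def]

end HomModule

namespace TiltAux

open CategoryTheory CategoryTheory.Abelian

section Hom

variable {R : Type} [Ring R] {M₁ M₂ M₃ : Type} [AddCommGroup M₁] [Module R M₁]
  [AddCommGroup M₂] [Module R M₂] [AddCommGroup M₃] [Module R M₃]

/-- Projective dimension at most `n`, in the sense of Mathlib. -/
def PD (R : Type) [Ring R] (n : ℕ) (M : Type) [AddCommGroup M] [Module R M] : Prop :=
  HasProjectiveDimensionLT (ModuleCat.of R M) (n + 1)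

/-- Vanishing of `Ext^n`. -/
def EV (R : Type) [Ring R] (n : ℕ) (M N : Type) [AddCommGroup M] [Module R M]
    [AddCommGroup N] [Module R N] : Prop :=
  Subsingleton (Ext (ModuleCat.of R M) (ModuleCat.of R N) n)

/-- the short complex attached to two linear maps. -/
abbrev sc (f : M₁ →ₗ[R] M₂) (g : M₂ →ₗ[R] M₃) (hfg : LinearMap.range f = LinearMap.ker g) :
    ShortComplex (ModuleCat.{0} R) :=
  ShortComplex.mk (ModuleCat.ofHom f) (ModuleCat.ofHom g) (by
    ext x
    have : f x ∈ LinearMap.ker g := hfg ▸ LinearMap.mem_range_self f x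
    simpa using this)

lemma sc_exact (f : M₁ →ₗ[R] M₂) (g : M₂ →ₗ[R] M₃) (hfg : LinearMap.range f = LinearMap.ker g)
    (hf : Injective f) (hg : Surjective g) : (sc f g hfg).ShortExact where
  exact := (ShortComplex.ShortExact.moduleCat_exact_iff_function_exact _).2
    (LinearMap.exact_iff.2 hfg.symm)
  mono_f := (ModuleCat.mono_iff_injective _).2 hf
  epi_g := (ModuleCat.epi_iff_surjective _).2 hg

lemma PD.x1 {f : M₁ →ₗ[R] M₂} {g : M₂ →ₗ[R] M₃} (hfg : LinearMap.range f = LinearMap.ker g)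
    (hf : Injective f) (hg : Surjective g) (n : ℕ) (h2 : PD R n M₂) (h3 : PD R (n + 1) M₃) :
    PD R n M₁ :=
  (sc_exact f g hfg hf hg).hasProjectiveDimensionLT_X₁ (n + 1) h2 h3

lemma PD.x3 {f : M₁ →ₗ[R] M₂} {g : M₂ →ₗ[R] M₃} (hfg : LinearMap.range f = LinearMap.ker g)
    (hf : Injective f) (hg : Surjective g) (n : ℕ) (h1 : PD R n M₁) (h2 : PD R (n + 1) M₂) :
    PD R (n + 1) M₃ :=
  (sc_exact f g hfg hf hg).hasProjectiveDimensionLT_X₃ (n + 1) h1 h2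

lemma PD.mono {n m : ℕ} (h : n ≤ m) (hM : PD R n M₁) : PD R m M₁ :=
  have : HasProjectiveDimensionLT (ModuleCat.of R M₁) (n + 1) := hM
  hasProjectiveDimensionLT_of_ge _ (n + 1) (m + 1) (by omega)

lemma PD.equiv {n : ℕ} (e : M₁ ≃ₗ[R] M₂) (hM : PD R n M₁) : PD R n M₂ :=
  have : HasProjectiveDimensionLT (ModuleCat.of R M₁) (n + 1) := hM
  hasProjectiveDimensionLT_of_iso e.toModuleIso (n + 1)

lemma pd_zero_iff : PD R 0 M₁ ↔ Module.Projective R M₁ := by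
  rw [IsProjective.iff_projective, projective_iff_hasProjectiveDimensionLT_one]
  rfl

lemma PD.ev {n i : ℕ} (hM : PD R n M₁) (hi : n < i) (N : Type) [AddCommGroup N] [Module R N] :
    EV R i M₁ N :=
  have : HasProjectiveDimensionLT (ModuleCat.of R M₁) (n + 1) := hM
  HasProjectiveDimensionLT.subsingleton _ (n + 1) i hi _

lemma pd_of_ev {n : ℕ} (h : ∀ i, n < i → ∀ (N : Type) [AddCommGroup N] [Module R N],
    EV R i M₁ N) : PD R n M₁ :=
  HasProjectiveDimensionLT.mk (fun i hi Y e => (h i hi Y).elim e 0)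

lemma ev_x1 {f : M₁ →ₗ[R] M₂} {g : M₂ →ₗ[R] M₃} (hfg : LinearMap.range f = LinearMap.ker g)
    (hf : Injective f) (hg : Surjective g) {N : Type} [AddCommGroup N] [Module R N]
    (n : ℕ) (h2 : EV R n M₂ N) (h3 : EV R (n + 1) M₃ N) : EV R n M₁ N := by
  have key : ∀ x : Ext (ModuleCat.of R M₁) (ModuleCat.of R N) n, x = 0 := by
    intro x
    obtain ⟨y, hy⟩ := Ext.contravariant_sequence_exact₁ (sc_exact f g hfg hf hg) _ x
      (add_comm 1 n) (h3.elim _ _)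
    have : y = 0 := h2.elim _ _
    rw [← hy, this, Ext.comp_zero]
  exact ⟨fun a b => by rw [key a, key b]⟩

lemma ev_one_of_extend {f : M₁ →ₗ[R] M₂} {g : M₂ →ₗ[R] M₃}
    (hfg : LinearMap.range f = LinearMap.ker g)
    (hf : Injective f) (hg : Surjective g) {N : Type} [AddCommGroup N] [Module R N]
    (h2 : EV R 1 M₂ N) (h : ∀ φ : M₁ →ₗ[R] N, ∃ ψ : M₂ →ₗ[R] N, ψ ∘ₗ f = φ) : EV R 1 M₃ N := by
  have key : ∀ x : Ext (ModuleCat.of R M₃) (ModuleCat.of R N) 1, x = 0 := by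
    intro x
    obtain ⟨y, hy⟩ := Ext.contravariant_sequence_exact₃ (sc_exact f g hfg hf hg) _ x
      (h2.elim _ _) (add_zero 1)
    obtain ⟨φ, rfl⟩ := (Ext.mk₀_bijective _ _).2 y
    obtain ⟨ψ, hψ⟩ := h φ.hom
    have e : φ = (sc f g hfg).f ≫ ModuleCat.ofHom ψ := by
      ext x
      exact (LinearMap.congr_fun hψ x).symm
    rw [← hy, e, ← Ext.mk₀_comp_mk₀]
    exact (sc_exact f g hfg hf hg).extClass_comp_assoc _
  exact ⟨fun a b => by rw [key a, key b]⟩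

lemma section_of_ev {f : M₁ →ₗ[R] M₂} {g : M₂ →ₗ[R] M₃}
    (hfg : LinearMap.range f = LinearMap.ker g)
    (hf : Injective f) (hg : Surjective g) (h : EV R 1 M₃ M₁) :
    ∃ s : M₃ →ₗ[R] M₂, g ∘ₗ s = LinearMap.id := by
  obtain ⟨y, hy⟩ := Ext.covariant_sequence_exact₃ (ModuleCat.of R M₃) (sc_exact f g hfg hf hg)
    (Ext.mk₀ (𝟙 (ModuleCat.of R M₃))) (zero_add 1) (h.elim _ _)
  obtain ⟨φ, rfl⟩ := (Ext.mk₀_bijective _ _).2 y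
  rw [Ext.mk₀_comp_mk₀] at hy
  have := (Ext.mk₀_bijective _ _).1 hy
  refine ⟨φ.hom, ?_⟩
  ext x
  exact congrArg (fun u : ModuleCat.of R M₃ ⟶ ModuleCat.of R M₃ => u.hom x) this

lemma ev_of_add {n : ℕ} {N : Type} [AddCommGroup N] [Module R N] {ι : Type} [Fintype ι]
    (a : ι → (M₂ →ₗ[R] M₁)) (b : ι → (M₁ →ₗ[R] M₂)) (hab : ∑ i, a i ∘ₗ b i = LinearMap.id)
    (h : EV R n M₂ N) : EV R n M₁ N := by
  have key : ∀ x : Ext (ModuleCat.of R M₁) (ModuleCat.of R N) n, x = 0 := by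
    intro x
    have e : 𝟙 (ModuleCat.of R M₁) = ∑ i, ModuleCat.ofHom (b i) ≫ ModuleCat.ofHom (a i) := by
      ext x
      have := LinearMap.congr_fun hab x
      simp at this
      simp [ModuleCat.hom_sum, this]
    rw [← Ext.mk₀_id_comp x, e, Ext.mk₀_sum, Ext.sum_comp]
    refine Finset.sum_eq_zero fun i _ => ?_
    rw [← Ext.mk₀_comp_mk₀, Ext.comp_assoc_of_second_deg_zero]
    rw [h.elim ((Ext.mk₀ (ModuleCat.ofHom (a i))).comp x (zero_add n)) 0, Ext.comp_zero]
  exact ⟨fun a b => by rw [key a, key b]⟩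

end Hom


section Conv

variable {R : Type} [Ring R]

lemma range_subtype_ker {M N : Type} [AddCommGroup M] [Module R M] [AddCommGroup N] [Module R N]
    (q : M →ₗ[R] N) : LinearMap.range (LinearMap.ker q).subtype = LinearMap.ker q :=
  Submodule.range_subtype _

lemma pd_of_pdLEcat : ∀ (n : ℕ) (X : ModuleCat.{0} R), pdLEcat R n X → PD R n X
  | 0, X, h => pd_zero_iff.2 h
  | n + 1, X, h => by
    obtain ⟨P, g, hP, -, hg, hK⟩ := h
    have h1 : PD R n (LinearMap.ker g) := pd_of_pdLEcat n _ hK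
    exact PD.x3 (range_subtype_ker g) (Submodule.injective_subtype _) hg n h1
      ((pd_zero_iff.2 hP).mono (Nat.zero_le _))

lemma pdLEcat_of_pd [IsNoetherianRing R] : ∀ (n : ℕ) (X : ModuleCat.{0} R),
    Module.Finite R X → PD R n X → pdLEcat R n X
  | 0, X, _, h => pd_zero_iff.1 h
  | n + 1, X, hX, h => by
    obtain ⟨m, p, hp⟩ := Module.Finite.exists_fin' R X
    refine ⟨ModuleCat.of R (Fin m → R), p, ?_, ?_, hp, ?_⟩
    · exact inferInstanceAs (Module.Projective R (Fin m → R))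
    · exact inferInstanceAs (Module.Finite R (Fin m → R))
    · refine pdLEcat_of_pd n _ ?_ ?_
      · exact inferInstanceAs (Module.Finite R (LinearMap.ker p))
      · exact PD.x1 (range_subtype_ker p) (Submodule.injective_subtype _) hp n
          ((pd_zero_iff.2 (inferInstanceAs (Module.Projective R (Fin m → R)))).mono
            (Nat.zero_le _)) h

end Conv

section PerpSec

variable {R : Type} [Ring R] {P T : Type} [AddCommGroup P] [Module R P]
  [AddCommGroup T] [Module R T]

/-- `Ext¹(T,N) = 0`, computed from a fixed presentation `g : P → T`. -/
def Perp (g : P →ₗ[R] T) (N : Type) [AddCommGroup N] [Module R N] : Prop :=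
  ∀ φ : LinearMap.ker g →ₗ[R] N, ∃ ψ : P →ₗ[R] N, ψ ∘ₗ (LinearMap.ker g).subtype = φ

lemma pushout {A B C N : Type} [AddCommGroup A] [Module R A] [AddCommGroup B] [Module R B]
    [AddCommGroup C] [Module R C] [AddCommGroup N] [Module R N]
    {f : A →ₗ[R] B} {g : B →ₗ[R] C} (hfg : LinearMap.range f = LinearMap.ker g)
    (hf : Injective f) (hg : Surjective g) (φ : A →ₗ[R] N) :
    ∃ (E : ModuleCat.{0} R) (i : N →ₗ[R] E) (q : E →ₗ[R] C) (j : B →ₗ[R] E),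
      Injective i ∧ Surjective q ∧ LinearMap.range i = LinearMap.ker q ∧
      j ∘ₗ f = i ∘ₗ φ ∧ q ∘ₗ j = g := by
  have hgf : ∀ a, g (f a) = 0 := fun a => by
    have : f a ∈ LinearMap.ker g := hfg ▸ LinearMap.mem_range_self f a
    simpa using this
  let W : Submodule R (N × B) := LinearMap.range (LinearMap.prod φ (-f))
  let q : ((N × B) ⧸ W) →ₗ[R] C := W.liftQ (g ∘ₗ LinearMap.snd R N B) (by
    rintro _ ⟨a, rfl⟩
    simp [hgf])
  let i : N →ₗ[R] ((N × B) ⧸ W) := W.mkQ ∘ₗ LinearMap.inl R N B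
  let j : B →ₗ[R] ((N × B) ⧸ W) := W.mkQ ∘ₗ LinearMap.inr R N B
  have hW : ∀ a, W.mkQ (φ a, - f a) = 0 := fun a => by
    rw [Submodule.mkQ_apply, Submodule.Quotient.mk_eq_zero]
    exact ⟨a, rfl⟩
  refine ⟨ModuleCat.of R ((N × B) ⧸ W), i, q, j, ?_, ?_, ?_, ?_, ?_⟩
  · refine (injective_iff_map_eq_zero i).2 fun n hn => ?_
    have : ((n, 0) : N × B) ∈ W := (Submodule.Quotient.mk_eq_zero W).1 hn
    obtain ⟨a, ha⟩ := this
    have h1 : φ a = n := congrArg Prod.fst ha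
    have h2 : - f a = 0 := congrArg Prod.snd ha
    have h3 : a = 0 := hf (by simpa using h2)
    rw [← h1, h3, map_zero]
  · intro c
    obtain ⟨b, rfl⟩ := hg c
    exact ⟨j b, by simp [j, q]⟩
  · ext e
    constructor
    · rintro ⟨n, rfl⟩
      simp [i, q]
    · intro he
      obtain ⟨⟨n, b⟩, rfl⟩ := Submodule.mkQ_surjective W e
      have hb : g b = 0 := by simpa [q] using he
      have : b ∈ LinearMap.range f := hfg ▸ hb
      obtain ⟨a, rfl⟩ := this
      refine ⟨n + φ a, ?_⟩
      have := hW a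
      calc i (n + φ a) = W.mkQ ((n, f a) + (φ a, - f a)) := by simp [i]
        _ = W.mkQ (n, f a) := by rw [map_add, this, add_zero]
  · ext a
    have := hW a
    have h2 : ((φ a, - f a) : N × B) = (φ a, 0) - (0, f a) := by simp
    rw [h2, map_sub, sub_eq_zero] at this
    exact this.symm
  · ext b
    simp [q, j]

lemma perp_self {g : P →ₗ[R] T} (hg : Surjective g) (h : Ext1Vanish R T T) : Perp g T := by
  intro φ
  obtain ⟨E, i, q, j, hi, hq, hiq, h1, h2⟩ :=
    pushout (range_subtype_ker g) (Submodule.injective_subtype _) hg φ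
  obtain ⟨r, hr⟩ := h E i q hi hq hiq
  refine ⟨r ∘ₗ j, ?_⟩
  rw [LinearMap.comp_assoc, h1, ← LinearMap.comp_assoc, hr, LinearMap.id_comp]

variable {N M E L : Type} [AddCommGroup N] [Module R N] [AddCommGroup M] [Module R M]
  [AddCommGroup E] [Module R E] [AddCommGroup L] [Module R L]

lemma perp_pi {g : P →ₗ[R] T} (h : Perp g N) (m : ℕ) : Perp g (Fin m → N) := by
  intro φ
  choose ψ hψ using fun i => h (LinearMap.proj i ∘ₗ φ)
  refine ⟨LinearMap.pi ψ, ?_⟩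
  ext x i
  exact LinearMap.congr_fun (hψ i) x

lemma perp_quot {g : P →ₗ[R] T} (hK : Module.Projective R (LinearMap.ker g)) (h : Perp g N)
    (q : N →ₗ[R] M) (hq : Surjective q) : Perp g M := by
  intro φ
  obtain ⟨φ', rfl⟩ := Module.projective_lifting_property q φ hq
  obtain ⟨ψ, rfl⟩ := h φ'
  exact ⟨q ∘ₗ ψ, rfl⟩

lemma factor {g : P →ₗ[R] T} (hg : Surjective g) (v : P →ₗ[R] N)
    (hv : ∀ x ∈ LinearMap.ker g, v x = 0) : ∃ w : T →ₗ[R] N, w ∘ₗ g = v := by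
  refine ⟨((LinearMap.ker g).liftQ v (fun x hx => hv x hx)) ∘ₗ
    (g.quotKerEquivOfSurjective hg).symm.toLinearMap, ?_⟩
  ext x
  have : (g.quotKerEquivOfSurjective hg).symm (g x) = (LinearMap.ker g).mkQ x := by
    rw [LinearEquiv.symm_apply_eq]
    rfl
  simp only [LinearMap.comp_apply, LinearEquiv.coe_coe]
  rw [this]
  rfl

lemma perp_lift {g : P →ₗ[R] T} (hg : Surjective g) (hP : Module.Projective R P)
    {f : L →ₗ[R] E} {q : E →ₗ[R] M} (hfq : LinearMap.range f = LinearMap.ker q)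
    (hf : Injective f) (hq : Surjective q) (h : Perp g L) (u : T →ₗ[R] M) :
    ∃ v : T →ₗ[R] E, q ∘ₗ v = u := by
  obtain ⟨v, hv⟩ := Module.projective_lifting_property q (u ∘ₗ g) hq
  have hqf : ∀ a, q (f a) = 0 := fun a => by
    have : f a ∈ LinearMap.ker q := hfq ▸ LinearMap.mem_range_self f a
    simpa using this
  have h1 : ∀ x : LinearMap.ker g, v x ∈ LinearMap.range f := fun x => by
    rw [hfq]
    have := LinearMap.congr_fun hv x
    simpa using this
  let φ : LinearMap.ker g →ₗ[R] L := (LinearEquiv.ofInjective f hf).symm.toLinearMap ∘ₗ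
    LinearMap.codRestrict (LinearMap.range f) (v ∘ₗ (LinearMap.ker g).subtype) h1
  have hφ : ∀ x, f (φ x) = v x := fun x => by
    have := LinearEquiv.apply_symm_apply (LinearEquiv.ofInjective f hf) ⟨v x, h1 x⟩
    exact congrArg Subtype.val this
  obtain ⟨w, hw⟩ := h φ
  obtain ⟨z, hz⟩ := factor hg (v - f ∘ₗ w) (fun x hx => by
    have h2 := LinearMap.congr_fun hw ⟨x, hx⟩
    have h3 := hφ ⟨x, hx⟩
    simp only [LinearMap.comp_apply, Submodule.subtype_apply] at h2
    simp [h2, h3])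
  refine ⟨z, ?_⟩
  ext t
  obtain ⟨p, rfl⟩ := hg t
  have h4 : z (g p) = v p - f (w p) := LinearMap.congr_fun hz p
  have h5 : q (v p) = u (g p) := LinearMap.congr_fun hv p
  rw [LinearMap.comp_apply, h4, map_sub, hqf, sub_zero, h5]

lemma perp_ker {g : P →ₗ[R] T} (hg : Surjective g) (h : Perp g E) (q : E →ₗ[R] M)
    (hl : ∀ u : T →ₗ[R] M, ∃ v : T →ₗ[R] E, q ∘ₗ v = u) : Perp g (LinearMap.ker q) := by
  intro φ
  obtain ⟨ψ, hψ⟩ := h ((LinearMap.ker q).subtype ∘ₗ φ)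
  have hψ' : ∀ x : LinearMap.ker g, ψ x = φ x := fun x => LinearMap.congr_fun hψ x
  obtain ⟨u, hu⟩ := factor hg (q ∘ₗ ψ) (fun x hx => by
    have := hψ' ⟨x, hx⟩
    simp only at this
    simp [this])
  obtain ⟨v, rfl⟩ := hl u
  have hu' : ∀ p, q (v (g p)) = q (ψ p) := fun p => LinearMap.congr_fun hu p
  refine ⟨LinearMap.codRestrict _ (ψ - v ∘ₗ g) (fun p => by simp [hu']), ?_⟩
  ext x
  have : g x = 0 := x.2
  simp [hψ', this]

lemma perp_ev {g : P →ₗ[R] T} (hg : Surjective g) (hP : Module.Projective R P) (h : Perp g N) :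
    EV R 1 T N :=
  ev_one_of_extend (range_subtype_ker g) (Submodule.injective_subtype _) hg
    ((pd_zero_iff.2 hP).ev one_pos N) h

lemma perp_section {g : P →ₗ[R] T} (hg : Surjective g) (hP : Module.Projective R P)
    {f : L →ₗ[R] E} {q : E →ₗ[R] M} (hfq : LinearMap.range f = LinearMap.ker q)
    (hf : Injective f) (hq : Surjective q) (h : Perp g L) (hM : InAddOf R T M) :
    ∃ s : M →ₗ[R] E, q ∘ₗ s = LinearMap.id := by
  obtain ⟨m, p, s, hps⟩ := hM
  choose v hv using fun i : Fin m => perp_lift hg hP hfq hf hq h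
    (p ∘ₗ LinearMap.single R (fun _ => T) i)
  refine ⟨(∑ i, v i ∘ₗ LinearMap.proj i) ∘ₗ s, ?_⟩
  rw [← LinearMap.comp_assoc, ← hps]
  congr 1
  refine LinearMap.pi_ext' fun i => ?_
  rw [← hv i]
  ext t
  simp only [LinearMap.comp_apply, LinearMap.sum_apply, LinearMap.proj_apply]
  rw [Finset.sum_eq_single i]
  · simp
  · intro b _ hb
    simp [Pi.single_eq_of_ne hb]
  · simp

/-- Modules in `Perp` are generated by `T`. -/
lemma perp_gen {g : P →ₗ[R] T} (hg : Surjective g) (hP : Module.Projective R P)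
    {T0 T1 : Type} [AddCommGroup T0] [Module R T0] [AddCommGroup T1] [Module R T1]
    {f : R →ₗ[R] T0} {g' : T0 →ₗ[R] T1} (hfg : LinearMap.range f = LinearMap.ker g')
    (hf : Injective f) (hg' : Surjective g') (h0 : InAddOf R T T0) (h1 : InAddOf R T T1)
    (h : Perp g N) (S : Submodule R N) (hS : ∀ u : T →ₗ[R] N, ∀ t, u t ∈ S) (x : N) : x ∈ S := by
  obtain ⟨E, i, q, j, hi, hq, hiq, h2, h3⟩ := pushout hfg hf hg' (LinearMap.toSpanSingleton R N x)
  obtain ⟨s, hs⟩ := perp_section hg hP hiq hi hq h h1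
  have key : ∀ b, (j - s ∘ₗ g') b ∈ LinearMap.range i := fun b => by
    rw [hiq]
    have h4 := LinearMap.congr_fun hs (g' b)
    have h5 := LinearMap.congr_fun h3 b
    simp only [LinearMap.comp_apply, LinearMap.id_apply] at h4 h5
    simp [h4, h5]
  let r : T0 →ₗ[R] N := (LinearEquiv.ofInjective i hi).symm.toLinearMap ∘ₗ
    LinearMap.codRestrict (LinearMap.range i) (j - s ∘ₗ g') key
  have hr : ∀ b, i (r b) = j b - s (g' b) := fun b => by
    have := LinearEquiv.apply_symm_apply (LinearEquiv.ofInjective i hi) ⟨_, key b⟩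
    exact congrArg Subtype.val this
  have hx : r (f 1) = x := by
    apply hi
    have h4 : g' (f 1) = 0 := by
      have : f 1 ∈ LinearMap.ker g' := hfg ▸ LinearMap.mem_range_self f 1
      simpa using this
    have h5 := LinearMap.congr_fun h2 1
    simp only [LinearMap.comp_apply, LinearMap.toSpanSingleton_apply, one_smul] at h5
    rw [hr, h4, map_zero, sub_zero, h5]
  obtain ⟨m, p, s', hps⟩ := h0
  have h6 : p (s' (f 1)) = f 1 := LinearMap.congr_fun hps _
  rw [← hx, ← h6, ← Finset.univ_sum_single (s' (f 1)), map_sum, map_sum]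
  refine Submodule.sum_mem _ fun l _ => ?_
  exact hS (r ∘ₗ p ∘ₗ LinearMap.single R (fun _ => T) l) _

end PerpSec

section HomFunctor

variable {R : Type} [Ring R] {T : Type} [AddCommGroup T] [Module R T]
variable {N M E L : Type} [AddCommGroup N] [Module R N] [AddCommGroup M] [Module R M]
  [AddCommGroup E] [Module R E] [AddCommGroup L] [Module R L]

/-- The functor `Hom(T,-)` on morphisms. -/
def post (T : Type) [AddCommGroup T] [Module R T] (q : E →ₗ[R] M) :
    (T →ₗ[R] E) →ₗ[(Module.End R T)ᵐᵒᵖ] (T →ₗ[R] M) where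
  toFun h := q ∘ₗ h
  map_add' a b := by ext x; simp
  map_smul' a b := by ext x; rfl

lemma post_apply (q : E →ₗ[R] M) (h : T →ₗ[R] E) : post T q h = q ∘ₗ h := rfl

/-- `Hom(T, T^m) = B^m`. -/
def homPi (T : Type) [AddCommGroup T] [Module R T] (m : ℕ) :
    (T →ₗ[R] (Fin m → T)) ≃ₗ[(Module.End R T)ᵐᵒᵖ] (Fin m → (Module.End R T)ᵐᵒᵖ) where
  toFun h i := MulOpposite.op (LinearMap.proj i ∘ₗ h)
  invFun c := LinearMap.pi fun i => (c i).unop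
  map_add' _ _ := rfl
  map_smul' _ _ := rfl
  left_inv _ := rfl
  right_inv _ := rfl

lemma homPi_projective (T : Type) [AddCommGroup T] [Module R T] (m : ℕ) :
    Module.Projective (Module.End R T)ᵐᵒᵖ (T →ₗ[R] (Fin m → T)) :=
  Module.Projective.of_equiv (homPi (R := R) T m).symm

lemma homPi_finite (T : Type) [AddCommGroup T] [Module R T] (m : ℕ) :
    Module.Finite (Module.End R T)ᵐᵒᵖ (T →ₗ[R] (Fin m → T)) :=
  Module.Finite.equiv (homPi (R := R) T m).symm

lemma post_ker (q : E →ₗ[R] M) :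
    LinearMap.range (post T (LinearMap.ker q).subtype) = LinearMap.ker (post T q) := by
  ext h
  constructor
  · rintro ⟨u, rfl⟩
    rw [LinearMap.mem_ker, post_apply, post_apply]
    ext t
    simp
  · intro hh
    have hh' : ∀ t, q (h t) = 0 := fun t => LinearMap.congr_fun (LinearMap.mem_ker.1 hh) t
    exact ⟨LinearMap.codRestrict _ h hh', rfl⟩

lemma post_inj {q : E →ₗ[R] M} (hq : Injective q) : Injective (post T q) := by
  intro a b hab
  ext t
  exact hq (LinearMap.congr_fun hab t)

lemma sum_comp_pi {m : ℕ} (s : Fin m → (T →ₗ[R] M)) (h : T →ₗ[R] (Fin m → T)) :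
    (∑ i, s i ∘ₗ LinearMap.proj i) ∘ₗ h =
      ∑ i, (MulOpposite.op (LinearMap.proj i ∘ₗ h) : (Module.End R T)ᵐᵒᵖ) • s i := by
  ext t
  simp [LinearMap.sum_apply, endOp_smul_def]

/-- A submodule of `Hom(T,M)` generated by finitely many elements is the range of `Hom(T,π)`
for some `π : T^m → M`. -/
lemma approx_sub (S : Submodule (Module.End R T)ᵐᵒᵖ (T →ₗ[R] M)) (hS : S.FG) :
    ∃ (m : ℕ) (π : (Fin m → T) →ₗ[R] M), LinearMap.range (post T π) = S := by
  obtain ⟨m, s, hs⟩ := Submodule.fg_iff_exists_fin_generating_family.1 hS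
  refine ⟨m, ∑ i, s i ∘ₗ LinearMap.proj i, ?_⟩
  ext u
  rw [← hs, Submodule.mem_span_range_iff_exists_fun]
  constructor
  · rintro ⟨h, rfl⟩
    exact ⟨_, (sum_comp_pi s h).symm⟩
  · rintro ⟨c, rfl⟩
    exact ⟨LinearMap.pi fun i => (c i).unop, sum_comp_pi s _⟩

lemma approx (h : Module.Finite (Module.End R T)ᵐᵒᵖ (T →ₗ[R] M)) :
    ∃ (m : ℕ) (π : (Fin m → T) →ₗ[R] M), ∀ u : T →ₗ[R] M, ∃ v, π ∘ₗ v = u := by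
  obtain ⟨m, π, hπ⟩ := approx_sub (R := R) (T := T) (M := M) ⊤ h.fg_top
  refine ⟨m, π, fun u => ?_⟩
  have : u ∈ LinearMap.range (post T π) := hπ ▸ Submodule.mem_top
  exact this

/-- Fullness of `Hom(T,-)`. -/
lemma full {m : ℕ} {π : (Fin m → T) →ₗ[R] M} (hπ : Surjective π)
    (hl : ∀ u : T →ₗ[R] M, ∃ v, π ∘ₗ v = u)
    (hgen : ∀ S : Submodule R (LinearMap.ker π),
      (∀ u : T →ₗ[R] LinearMap.ker π, ∀ t, u t ∈ S) → ∀ x, x ∈ S)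
    (φ : (T →ₗ[R] M) →ₗ[(Module.End R T)ᵐᵒᵖ] (T →ₗ[R] N)) :
    ∃ σ : M →ₗ[R] N, ∀ u, σ ∘ₗ u = φ u := by
  let ψ : (Fin m → T) →ₗ[R] N :=
    ∑ i, φ (π ∘ₗ LinearMap.single R (fun _ => T) i) ∘ₗ LinearMap.proj i
  have hψ : ∀ h : T →ₗ[R] (Fin m → T), ψ ∘ₗ h = φ (π ∘ₗ h) := by
    intro h
    rw [sum_comp_pi]
    simp_rw [← map_smul]
    rw [← map_sum]
    congr 1
    ext t
    simp only [LinearMap.sum_apply, endOp_smul_def, MulOpposite.unop_op, LinearMap.comp_apply,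
      LinearMap.proj_apply, LinearMap.coe_single]
    rw [← map_sum, Finset.univ_sum_single]
  obtain ⟨σ, hσ⟩ := factor hπ ψ (fun x hx => by
    have := hgen (LinearMap.ker (ψ ∘ₗ (LinearMap.ker π).subtype)) (fun u t => by
      have h1 := LinearMap.congr_fun (hψ ((LinearMap.ker π).subtype ∘ₗ u)) t
      have h2 : π ∘ₗ ((LinearMap.ker π).subtype ∘ₗ u) = 0 := by
        ext t
        simp
      rw [h2, map_zero] at h1
      exact h1) ⟨x, hx⟩
    exact this)
  refine ⟨σ, fun u => ?_⟩
  obtain ⟨v, rfl⟩ := hl u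
  rw [← hψ, ← hσ, LinearMap.comp_assoc]

end HomFunctor

section Main

/-- The data used in the proof. -/
structure Setup (R : Type) [Ring R] (T P T0 T1 : Type) [AddCommGroup T] [Module R T]
    [AddCommGroup P] [Module R P] [AddCommGroup T0] [Module R T0] [AddCommGroup T1]
    [Module R T1] (g : P →ₗ[R] T) (f : R →ₗ[R] T0) (g' : T0 →ₗ[R] T1) : Prop where
  hg : Surjective g
  hP : Module.Projective R P
  hK : Module.Projective R (LinearMap.ker g)
  self : Perp g T
  h0 : InAddOf R T T0
  h1 : InAddOf R T T1
  hf : Injective f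
  hg' : Surjective g'
  hfg : LinearMap.range f = LinearMap.ker g'
  noeth : IsNoetherianRing R
  fin : Module.Finite R T
  homfin : ∀ (M : Type) [AddCommGroup M] [Module R M], Module.Finite R M →
    Module.Finite (Module.End R T)ᵐᵒᵖ (T →ₗ[R] M)
  noethB : IsNoetherianRing (Module.End R T)ᵐᵒᵖ

variable {R : Type} [Ring R] {T P T0 T1 : Type} [AddCommGroup T] [Module R T]
    [AddCommGroup P] [Module R P] [AddCommGroup T0] [Module R T0] [AddCommGroup T1]
    [Module R T1] {g : P →ₗ[R] T} {f : R →ₗ[R] T0} {g' : T0 →ₗ[R] T1}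
variable {M N : Type} [AddCommGroup M] [Module R M] [AddCommGroup N] [Module R N]

lemma Setup.gen (S : Setup R T P T0 T1 g f g') (h : Perp g N) (V : Submodule R N)
    (hV : ∀ u : T →ₗ[R] N, ∀ t, u t ∈ V) (x : N) : x ∈ V :=
  perp_gen S.hg S.hP S.hfg S.hf S.hg' S.h0 S.h1 h V hV x

lemma Setup.approx (S : Setup R T P T0 T1 g f g') (hM : Module.Finite R M) (h : Perp g M) :
    ∃ (m : ℕ) (π : (Fin m → T) →ₗ[R] M), Surjective π ∧
      (∀ u : T →ₗ[R] M, ∃ v, π ∘ₗ v = u) ∧ Perp g (LinearMap.ker π) ∧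
      Module.Finite R (LinearMap.ker π) := by
  obtain ⟨m, π, hπ⟩ := TiltAux.approx (S.homfin M hM)
  have := S.noeth
  have := S.fin
  refine ⟨m, π, ?_, hπ, perp_ker S.hg (perp_pi S.self m) π hπ, inferInstance⟩
  intro x
  refine S.gen h (LinearMap.range π) (fun u t => ?_) x
  obtain ⟨v, rfl⟩ := hπ u
  exact ⟨v t, rfl⟩

lemma Setup.evT (S : Setup R T P T0 T1 g f g') (h : Perp g N) (i : ℕ) : EV R (i + 1) T N := by
  rcases i with _ | i
  · exact perp_ev S.hg S.hP h
  · have : PD R 1 T := PD.x3 (range_subtype_ker g) (Submodule.injective_subtype _) S.hg 0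
      (pd_zero_iff.2 S.hK) ((pd_zero_iff.2 S.hP).mono (Nat.zero_le _))
    exact this.ev (by omega) N

lemma Setup.pdT (S : Setup R T P T0 T1 g f g') : PD R 1 T :=
  PD.x3 (range_subtype_ker g) (Submodule.injective_subtype _) S.hg 0
      (pd_zero_iff.2 S.hK) ((pd_zero_iff.2 S.hP).mono (Nat.zero_le _))

lemma ev_of_inAdd {i : ℕ} (hM : InAddOf R T M) (h : EV R i T N) : EV R i M N := by
  obtain ⟨m, p, s, hps⟩ := hM
  refine ev_of_add (fun j => p ∘ₗ LinearMap.single R (fun _ => T) j)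
    (fun j => LinearMap.proj j ∘ₗ s) ?_ h
  rw [← hps]
  ext x
  simp only [LinearMap.sum_apply, LinearMap.comp_apply, LinearMap.proj_apply,
    LinearMap.coe_single]
  rw [← map_sum, Finset.univ_sum_single]

lemma inAdd_pi (m : ℕ) : InAddOf R T (Fin m → T) :=
  ⟨m, LinearMap.id, LinearMap.id, rfl⟩

lemma pd_of_inAdd {i : ℕ} (hM : InAddOf R T M) (h : PD R i T) : PD R i M :=
  pd_of_ev fun j hj N _ _ => ev_of_inAdd hM (h.ev hj N)

lemma inAdd_pi_of (n : ℕ) (hM : InAddOf R T M) : InAddOf R T (Fin n → M) := by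
  obtain ⟨m, p, s, hps⟩ := hM
  let e : (Fin n → Fin m → T) ≃ₗ[R] (Fin (n * m) → T) :=
    (LinearEquiv.curry R T (Fin n) (Fin m)).symm.trans
      (LinearEquiv.funCongrLeft R T finProdFinEquiv.symm)
  refine ⟨n * m, (LinearMap.pi fun i => p ∘ₗ LinearMap.proj i) ∘ₗ e.symm.toLinearMap,
    e.toLinearMap ∘ₗ (LinearMap.pi fun i => s ∘ₗ LinearMap.proj i), ?_⟩
  apply LinearMap.ext
  intro x
  funext i
  have := LinearMap.congr_fun hps (x i)
  simp only [LinearMap.comp_apply, LinearEquiv.coe_coe, LinearEquiv.symm_apply_apply]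
  exact this

lemma post_surj {E : Type} [AddCommGroup E] [Module R E] {π : E →ₗ[R] M}
    (hl : ∀ u : T →ₗ[R] M, ∃ v, π ∘ₗ v = u) : Surjective (post T π) :=
  fun u => hl u

lemma Setup.part1 (S : Setup R T P T0 T1 g f g') (d : ℕ) : ∀ (M : Type) [AddCommGroup M]
    [Module R M], Module.Finite R M → Perp g M →
    (∀ (N : Type) [AddCommGroup N] [Module R N], Perp g N → EV R (d + 1) M N) →
    PD (Module.End R T)ᵐᵒᵖ d (T →ₗ[R] M) := by
  induction d with
  | zero =>
    intro M _ _ hM h hE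
    obtain ⟨m, π, hπ, hl, hk, hkf⟩ := S.approx hM h
    obtain ⟨s, hs⟩ := section_of_ev (range_subtype_ker π) (Submodule.injective_subtype _) hπ
      (hE _ hk)
    have := homPi_projective (R := R) T m
    refine pd_zero_iff.2 (Module.Projective.of_split (post T s) (post T π) ?_)
    ext u t
    exact LinearMap.congr_fun hs (u t)
  | succ d ih =>
    intro M _ _ hM h hE
    obtain ⟨m, π, hπ, hl, hk, hkf⟩ := S.approx hM h
    refine PD.x3 (R := (Module.End R T)ᵐᵒᵖ) (f := post T (LinearMap.ker π).subtype)
      (g := post T π) (post_ker π) (post_inj (Submodule.injective_subtype _)) (post_surj hl) d ?_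
      ((pd_zero_iff.2 (homPi_projective T m)).mono (Nat.zero_le _))
    refine ih _ hkf hk fun N _ _ hN => ?_
    exact ev_x1 (range_subtype_ker π) (Submodule.injective_subtype _) hπ (d + 1)
      (ev_of_inAdd (inAdd_pi m) (S.evT hN d)) (hE N hN)

lemma Setup.part2 (S : Setup R T P T0 T1 g f g') (d : ℕ) : ∀ (M : Type) [AddCommGroup M]
    [Module R M], Module.Finite R M → Perp g M → PD (Module.End R T)ᵐᵒᵖ d (T →ₗ[R] M) →
    PD R (d + 1) M := by
  induction d with
  | zero =>
    intro M _ _ hM h hE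
    obtain ⟨m, π, hπ, hl, hk, hkf⟩ := S.approx hM h
    have := pd_zero_iff.1 hE
    obtain ⟨s, hs⟩ := Module.projective_lifting_property (post T π) LinearMap.id (post_surj hl)
    obtain ⟨σ, hσ⟩ := full hπ hl (fun V hV x => S.gen hk V hV x) s
    refine pd_of_inAdd ⟨m, π, σ, ?_⟩ S.pdT
    ext x
    have := S.gen h (LinearMap.ker (π ∘ₗ σ - LinearMap.id)) (fun u t => by
      have h1 := LinearMap.congr_fun (hσ u) t
      have h2 := LinearMap.congr_fun (LinearMap.congr_fun hs u) t
      simp only [LinearMap.comp_apply, post_apply, LinearMap.id_apply] at h1 h2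
      simp [h1, h2]) x
    exact sub_eq_zero.1 this
  | succ d ih =>
    intro M _ _ hM h hE
    obtain ⟨m, π, hπ, hl, hk, hkf⟩ := S.approx hM h
    refine PD.x3 (range_subtype_ker π) (Submodule.injective_subtype _) hπ (d + 1) ?_
      ((pd_of_inAdd (inAdd_pi m) S.pdT).mono (by omega))
    refine ih _ hkf hk ?_
    exact PD.x1 (R := (Module.End R T)ᵐᵒᵖ) (f := post T (LinearMap.ker π).subtype)
      (g := post T π) (post_ker π) (post_inj (Submodule.injective_subtype _)) (post_surj hl) d
      ((pd_zero_iff.2 (homPi_projective T m)).mono (Nat.zero_le _)) hE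

lemma Setup.main1 (S : Setup R T P T0 T1 g f g') (d : ℕ) (h : GlobalDimLE R d) :
    GlobalDimLE (Module.End R T)ᵐᵒᵖ (d + 1) := by
  intro X hX
  have := S.noeth
  have := S.fin
  have := S.noethB
  refine pdLEcat_of_pd _ X hX ?_
  obtain ⟨n, p₀, hp₀⟩ := Module.Finite.exists_fin' (Module.End R T)ᵐᵒᵖ X
  let p : (T →ₗ[R] (Fin n → T)) →ₗ[(Module.End R T)ᵐᵒᵖ] X := p₀ ∘ₗ (homPi T n).toLinearMap
  have hp : Surjective p := hp₀.comp (homPi T n).surjective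
  refine PD.x3 (range_subtype_ker p) (Submodule.injective_subtype _) hp d ?_
    ((pd_zero_iff.2 (homPi_projective T n)).mono (Nat.zero_le _))
  have := homPi_finite (R := R) T n
  have hfg : (LinearMap.ker p).FG := IsNoetherian.noetherian _
  obtain ⟨m, α, hα⟩ := approx_sub _ hfg
  obtain ⟨l, β, hβ⟩ := TiltAux.approx (S.homfin (LinearMap.ker α) inferInstance)
  let γ : (Fin l → T) →ₗ[R] (Fin m → T) := (LinearMap.ker α).subtype ∘ₗ β
  let I := LinearMap.range γ
  have hI : Perp g I := perp_quot S.hK (perp_pi S.self l) γ.rangeRestrict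
    γ.surjective_rangeRestrict
  have hl : ∀ u : T →ₗ[R] ((Fin m → T) ⧸ I), ∃ v, I.mkQ ∘ₗ v = u :=
    perp_lift S.hg S.hP (f := I.subtype) (by simp) (Submodule.injective_subtype _)
      (Submodule.mkQ_surjective I) hI
  have hM : Perp g ((Fin m → T) ⧸ I) := perp_quot S.hK (perp_pi S.self m) I.mkQ
    (Submodule.mkQ_surjective I)
  have hpd : PD R d ((Fin m → T) ⧸ I) :=
    pd_of_pdLEcat d (ModuleCat.of R ((Fin m → T) ⧸ I))
      (h _ (inferInstanceAs (Module.Finite R ((Fin m → T) ⧸ I))))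
  have hB : PD (Module.End R T)ᵐᵒᵖ d (T →ₗ[R] ((Fin m → T) ⧸ I)) :=
    S.part1 d _ inferInstance hM fun N _ _ _ => hpd.ev (Nat.lt_succ_self d) N
  have hker : LinearMap.ker (post T I.mkQ) = LinearMap.ker (post T α) := by
    ext u
    rw [LinearMap.mem_ker, LinearMap.mem_ker, post_apply, post_apply]
    constructor
    · intro hu
      ext1 t
      have : u t ∈ I := (Submodule.Quotient.mk_eq_zero I).1 (LinearMap.congr_fun hu t)
      obtain ⟨y, hy⟩ := this
      rw [LinearMap.comp_apply, ← hy]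
      exact (β y).2
    · intro hu
      obtain ⟨v, hv⟩ := hβ (LinearMap.codRestrict _ u (fun t => LinearMap.congr_fun hu t))
      ext1 t
      refine (Submodule.Quotient.mk_eq_zero I).2 ⟨v t, ?_⟩
      exact congrArg Subtype.val (LinearMap.congr_fun hv t)
  have e1 := (post T I.mkQ).quotKerEquivOfSurjective (post_surj hl)
  have e2 := (post T α).quotKerEquivRange
  refine hB.equiv ((e1.symm.trans (Submodule.quotEquivOfEq _ _ hker)).trans
    (e2.trans (LinearEquiv.ofEq _ _ hα)))

lemma Setup.main2 (S : Setup R T P T0 T1 g f g') (d : ℕ)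
    (h : GlobalDimLE (Module.End R T)ᵐᵒᵖ d) : GlobalDimLE R (d + 1) := by
  intro X hX
  have := S.noeth
  have := S.fin
  refine pdLEcat_of_pd _ X hX ?_
  obtain ⟨n, p, hp⟩ := Module.Finite.exists_fin' R X
  let F : (Fin n → R) →ₗ[R] (Fin n → T0) := LinearMap.pi fun i => f ∘ₗ LinearMap.proj i
  let G : (Fin n → T0) →ₗ[R] (Fin n → T1) := LinearMap.pi fun i => g' ∘ₗ LinearMap.proj i
  have hF : Injective F := fun a b hab => funext fun i => S.hf (congrFun hab i)
  have hG : Surjective G := fun a => by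
    choose b hb using fun i => S.hg' (a i)
    exact ⟨b, funext hb⟩
  have hFG : LinearMap.range F = LinearMap.ker G := by
    ext x
    constructor
    · rintro ⟨y, rfl⟩
      refine funext fun i => ?_
      have : f (y i) ∈ LinearMap.ker g' := S.hfg ▸ LinearMap.mem_range_self f _
      exact this
    · intro hx
      have : ∀ i, ∃ y, f y = x i := fun i => by
        have : x i ∈ LinearMap.range f := S.hfg ▸ (congrFun hx i : g' (x i) = 0)
        exact this
      choose y hy using this
      exact ⟨y, funext hy⟩
  obtain ⟨E, i, q, j, hi, hq, hiq, h1, h2⟩ := pushout hFG hF hG p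
  -- `E` is a quotient of `T0^n`
  have hj : Surjective j := by
    intro e
    obtain ⟨b, hb⟩ := hG (q e)
    have : e - j b ∈ LinearMap.range i := by
      rw [hiq, LinearMap.mem_ker, map_sub, ← hb, ← h2]
      simp
    obtain ⟨x, hx⟩ := this
    obtain ⟨a, rfl⟩ := hp x
    refine ⟨F a + b, ?_⟩
    have h3 : j (F a) = i (p a) := LinearMap.congr_fun h1 a
    rw [map_add, h3, hx, sub_add_cancel]
  obtain ⟨m, p', s', hps⟩ := inAdd_pi_of n S.h0
  have hp' : Surjective p' := fun x => ⟨s' x, LinearMap.congr_fun hps x⟩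
  have hjp : Surjective (j ∘ₗ p') := hj.comp hp'
  have hE : Perp g E := perp_quot S.hK (perp_pi S.self m) (j ∘ₗ p') hjp
  have hEf : Module.Finite R E := Module.Finite.of_surjective (j ∘ₗ p') hjp
  have hEpd : PD R (d + 1) E := S.part2 d E hEf hE
    (pd_of_pdLEcat d (ModuleCat.of _ (T →ₗ[R] E)) (h _ (S.homfin E hEf)))
  exact PD.x1 hiq hi hq (d + 1) hEpd
    ((pd_of_inAdd (inAdd_pi_of n S.h1) S.pdT).mono (by omega))

end Main

section Finiteness

variable {R : Type} [Ring R] {T M : Type} [AddCommGroup T] [Module R T] [AddCommGroup M] [Module R M]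

lemma hom_finite_aux (k : Type) [CommRing k] [IsNoetherianRing k] [Algebra k R] [Module.Finite k R]
    [Module k T] [IsScalarTower k R T] [Module k M] [IsScalarTower k R M]
    [Module.Finite R T] [Module.Finite R M] :
    IsNoetherian (Module.End R T)ᵐᵒᵖ (T →ₗ[R] M) := by
  have : Module.Finite k M := Module.Finite.trans R M
  obtain ⟨n, p, hp⟩ := Module.Finite.exists_fin' R T
  let F : (T →ₗ[R] M) →ₗ[k] (Fin n → M) :=
    { toFun := fun h i => h (p (Pi.single i 1))
      map_add' := fun a b => rfl
      map_smul' := fun a b => rfl }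
  have hF : Injective F := by
    intro a b hab
    have : a ∘ₗ p = b ∘ₗ p := by
      refine LinearMap.pi_ext' fun i => LinearMap.ext_ring ?_
      exact congrFun hab i
    ext t
    obtain ⟨x, rfl⟩ := hp t
    exact LinearMap.congr_fun this x
  have hk : IsNoetherian k (T →ₗ[R] M) := isNoetherian_of_injective F hF
  have : IsScalarTower k (Module.End R T)ᵐᵒᵖ (T →ₗ[R] M) := ⟨fun a b h => by
    ext t
    simp only [endOp_smul_def, MulOpposite.unop_smul, LinearMap.smul_apply, LinearMap.comp_apply]
    exact h.map_smul_of_tower a _⟩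
  exact isNoetherian_of_tower k hk

lemma hom_finite (k : Type) [CommRing k] [IsNoetherianRing k] [Algebra k R] [Module.Finite k R]
    [Module.Finite R T] [Module.Finite R M] :
    IsNoetherian (Module.End R T)ᵐᵒᵖ (T →ₗ[R] M) := by
  let _ : Module k T := Module.compHom T (algebraMap k R)
  let _ : Module k M := Module.compHom M (algebraMap k R)
  have : IsScalarTower k R T := ⟨fun a b t => by
    rw [Algebra.smul_def, mul_smul]
    rfl⟩
  have : IsScalarTower k R M := ⟨fun a b t => by
    rw [Algebra.smul_def, mul_smul]
    rfl⟩
  exact hom_finite_aux k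

lemma noethB (k : Type) [CommRing k] [IsNoetherianRing k] [Algebra k R] [Module.Finite k R]
    [Module.Finite R T] : IsNoetherianRing (Module.End R T)ᵐᵒᵖ := by
  have h : IsNoetherian (Module.End R T)ᵐᵒᵖ (T →ₗ[R] (Fin 1 → T)) := hom_finite k
  have h2 : IsNoetherian (Module.End R T)ᵐᵒᵖ (Fin 1 → (Module.End R T)ᵐᵒᵖ) :=
    isNoetherian_of_linearEquiv (homPi T 1)
  exact isNoetherian_of_linearEquiv
    (LinearEquiv.funUnique (Fin 1) (Module.End R T)ᵐᵒᵖ (Module.End R T)ᵐᵒᵖ)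

end Finiteness

end TiltAux
theorem stmt16 (Λ : Type) [Ring Λ] (k : Type) [CommRing k] [IsArtinianRing k] [Algebra k Λ]
    [Module.Finite k Λ]
    (T : Type) [AddCommGroup T] [Module Λ T] [Module.Finite Λ T]
    (hT : IsTilting Λ T) :
    (∀ d, GlobalDimLE Λ d → GlobalDimLE ((Module.End Λ T)ᵐᵒᵖ) (d + 1)) ∧
    (∀ d, GlobalDimLE ((Module.End Λ T)ᵐᵒᵖ) d → GlobalDimLE Λ (d + 1)) := by 
  have : IsNoetherianRing k := inferInstance
  have hN : IsNoetherianRing Λ := isNoetherian_of_tower k inferInstance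
  obtain ⟨hpd, hext, T0, T1, f, g', h0, h1, hf, hg', hfg⟩ := hT
  obtain ⟨P, g, hP, -, hg, hK⟩ := hpd
  have S : TiltAux.Setup Λ T P T0 T1 g f g' :=
    { hg := hg
      hP := hP
      hK := hK
      self := TiltAux.perp_self hg hext
      h0 := h0
      h1 := h1
      hf := hf
      hg' := hg'
      hfg := hfg
      noeth := hN
      fin := inferInstance
      homfin := fun M _ _ _ =>
        have : IsNoetherian (Module.End Λ T)ᵐᵒᵖ (T →ₗ[Λ] M) := TiltAux.hom_finite k
        inferInstance
      noethB := TiltAux.noethB k }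
  exact ⟨S.main1, S.main2⟩
end

section
/- Let Γ be an artin algebra with dominant dimension at least 2, T_C the unique tilting module in C_Γ, and B_C = End_Γ(T_C)^op. If M ∈ Gen(T_C) has projective dimension d ≥ 1 over Γ, then the B_C-module Hom_Γ(T_C, M) has projective dimension exactly d − 1. -/
open Function LinearMap

section Aux

open CategoryTheory

variable {R : Type} [Ring R]

/-- Projective dimension `< n`, through Mathlib's notion. -/
abbrev PDLT (R : Type) [Ring R] (n : ℕ) (X : Type) [AddCommGroup X] [Module R X] : Prop :=
  HasProjectiveDimensionLT (ModuleCat.of R X) n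

section SES
variable {A B C : Type} [AddCommGroup A] [Module R A] [AddCommGroup B] [Module R B]
  [AddCommGroup C] [Module R C] (f : A →ₗ[R] B) (g : B →ₗ[R] C)

lemma ses_exists (hf : Injective f) (hg : Surjective g) (h : Exact f g) :
    ∃ w, (ShortComplex.mk (ModuleCat.ofHom f) (ModuleCat.ofHom g) w).ShortExact := by
  refine ⟨?_, ?_⟩
  · ext x
    exact h.apply_apply_eq_zero x
  · refine ShortComplex.ShortExact.mk' ?_ ?_ ?_
    · rw [ShortComplex.ShortExact.moduleCat_exact_iff_function_exact]
      exact h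
    · exact (ModuleCat.mono_iff_injective _).2 hf
    · exact (ModuleCat.epi_iff_surjective _).2 hg

variable {f g}

lemma pdlt_1 (hf : Injective f) (hg : Surjective g) (h : Exact f g) {n : ℕ}
    (h2 : PDLT R n B) (h3 : PDLT R (n + 1) C) : PDLT R n A := by
  obtain ⟨w, hs⟩ := ses_exists f g hf hg h
  exact hs.hasProjectiveDimensionLT_X₁ n h2 h3

lemma pdlt_2 (hf : Injective f) (hg : Surjective g) (h : Exact f g) {n : ℕ}
    (h2 : PDLT R n A) (h3 : PDLT R n C) : PDLT R n B := by
  obtain ⟨w, hs⟩ := ses_exists f g hf hg h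
  exact hs.hasProjectiveDimensionLT_X₂ n h2 h3

lemma pdlt_3 (hf : Injective f) (hg : Surjective g) (h : Exact f g) {n : ℕ}
    (h2 : PDLT R n A) (h3 : PDLT R (n + 1) B) : PDLT R (n + 1) C := by
  obtain ⟨w, hs⟩ := ses_exists f g hf hg h
  exact hs.hasProjectiveDimensionLT_X₃ n h2 h3

end SES

variable {X Y : Type} [AddCommGroup X] [Module R X] [AddCommGroup Y] [Module R Y]

lemma exact_ker (g : X →ₗ[R] Y) : Exact (LinearMap.ker g).subtype g := by
  rw [LinearMap.exact_iff, Submodule.range_subtype]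

lemma pdlt_one_iff : PDLT R 1 X ↔ Module.Projective R X := by
  rw [PDLT, ← projective_iff_hasProjectiveDimensionLT_one, ← IsProjective.iff_projective]

lemma pdlt_mono {m n : ℕ} (h : m ≤ n) (hX : PDLT R m X) : PDLT R n X :=
  hasProjectiveDimensionLT_of_ge _ m n h

lemma pdlt_of_proj {n : ℕ} (h : Module.Projective R X) : PDLT R (n + 1) X :=
  pdlt_mono (by omega) (pdlt_one_iff.2 h)

lemma pdlt_of_retract (p : Y →ₗ[R] X) (s : X →ₗ[R] Y) (h : p ∘ₗ s = LinearMap.id) {n : ℕ}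
    (hY : PDLT R n Y) : PDLT R n X := by
  let r : Retract (ModuleCat.of R X) (ModuleCat.of R Y) :=
    ⟨ModuleCat.ofHom s, ModuleCat.ofHom p, by rw [← ModuleCat.ofHom_comp, h]; rfl⟩
  exact r.hasProjectiveDimensionLT n

lemma pdlt_fin {n : ℕ} (hX : PDLT R n X) (m : ℕ) : PDLT R n (Fin m → X) := by
  induction m with
  | zero =>
    have : HasProjectiveDimensionLT (ModuleCat.of R (Fin 0 → X)) 0 := by
      rw [hasProjectiveDimensionLT_zero_iff_isZero]
      exact ModuleCat.isZero_of_subsingleton _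
    exact pdlt_mono (Nat.zero_le n) this
  | succ m ih =>
    refine pdlt_2 (f := LinearMap.single R (fun _ : Fin (m + 1) => X) 0)
      (g := LinearMap.funLeft R X Fin.succ) ?_ ?_ ?_ hX ih
    · exact Pi.single_injective (M := fun _ : Fin (m + 1) => X) 0
    · exact LinearMap.funLeft_surjective_of_injective _ _ _ (Fin.succ_injective m)
    · intro y
      constructor
      · intro h
        refine ⟨y 0, ?_⟩
        ext i
        refine Fin.cases ?_ (fun j => ?_) i
        · simp
        · have := congrFun h j
          simp [LinearMap.funLeft_apply] at this
          simp [this]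
      · rintro ⟨x, rfl⟩
        ext j
        simp [LinearMap.funLeft_apply]

lemma pdlt_of_pdLEcat (n : ℕ) : ∀ X : ModuleCat.{0} R, pdLEcat R n X → PDLT R (n + 1) X := by
  induction n with
  | zero => intro X h; exact pdlt_one_iff.2 h
  | succ n ih =>
    rintro X ⟨P, g, hP, -, hg, hk⟩
    exact pdlt_3 (Submodule.subtype_injective _) hg (exact_ker g) (ih _ hk) (pdlt_of_proj hP)

lemma pdlt_of_pdLE {n : ℕ} (h : pdLE R n X) : PDLT R (n + 1) X := pdlt_of_pdLEcat n _ h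

lemma pdLEcat_of_pdlt [IsNoetherianRing R] (n : ℕ) :
    ∀ X : ModuleCat.{0} R, Module.Finite R X → PDLT R (n + 1) X → pdLEcat R n X := by
  induction n with
  | zero => intro X _ h; exact pdlt_one_iff.1 h
  | succ n ih =>
    intro X hX h
    obtain ⟨m, g, hg⟩ := Module.Finite.exists_fin' R X
    refine ⟨ModuleCat.of R (Fin m → R), g, ?_, ?_, hg, ih _ ?_ ?_⟩
    · change Module.Projective R (Fin m → R); infer_instance
    · change Module.Finite R (Fin m → R); infer_instance
    · change Module.Finite R (LinearMap.ker g); infer_instance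
    · exact pdlt_1 (Submodule.subtype_injective _) hg (exact_ker g)
        (pdlt_of_proj (inferInstance : Module.Projective R (Fin m → R))) h

lemma pdLEcat_of_equiv (n : ℕ) (X Y : ModuleCat.{0} R) (e : X ≃ₗ[R] Y) (h : pdLEcat R n X) :
    pdLEcat R n Y := by
  cases n with
  | zero =>
    have : Module.Projective R X := h
    exact Module.Projective.of_equiv e
  | succ n =>
    obtain ⟨P, g, hP, hF, hg, hk⟩ := h
    refine ⟨P, e.toLinearMap ∘ₗ g, hP, hF, e.surjective.comp hg, ?_⟩
    have : LinearMap.ker (e.toLinearMap ∘ₗ g) = LinearMap.ker g := by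
      ext x; simp
    rw [this]
    exact hk

/-! Lifting along extensions by `T`. -/

variable {T : Type} [AddCommGroup T] [Module R T]

lemma lift_of_ext1 (hT : Ext1Vanish R T T) {E Y : Type} [AddCommGroup E] [Module R E]
    [AddCommGroup Y] [Module R Y] (f : T →ₗ[R] E) (g : E →ₗ[R] Y) (hf : Injective f)
    (hg : Surjective g) (hfg : Exact f g) (t : T →ₗ[R] Y) : ∃ l : T →ₗ[R] E, g ∘ₗ l = t := by
  -- the pullback
  let P : Submodule R (E × T) :=
    LinearMap.ker (g ∘ₗ LinearMap.fst R E T - t ∘ₗ LinearMap.snd R E T)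
  have hP : ∀ z : E × T, z ∈ P ↔ g z.1 = t z.2 := by
    intro z; simp [P, sub_eq_zero]
  let i : T →ₗ[R] P := LinearMap.codRestrict P (LinearMap.inl R E T ∘ₗ f) (by
    intro x; rw [hP]; simp [hfg.apply_apply_eq_zero])
  let q : P →ₗ[R] T := LinearMap.snd R E T ∘ₗ P.subtype
  have hi : Injective i := by
    intro x y h
    apply hf
    exact congrArg (fun z : P => z.1.1) h
  have hq : Surjective q := by
    intro y
    obtain ⟨e, he⟩ := hg (t y)
    exact ⟨⟨(e, y), (hP _).2 he⟩, rfl⟩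
  have hiq : Exact i q := by
    intro z
    constructor
    · intro h
      have hz := (hP z.1).1 z.2
      have h' : z.1.2 = 0 := h
      rw [h', map_zero] at hz
      obtain ⟨x, hx⟩ := (hfg _).1 hz
      refine ⟨x, ?_⟩
      apply Subtype.ext
      exact Prod.ext hx h'.symm
    · rintro ⟨x, rfl⟩
      rfl
  have hr := hT (ModuleCat.of R P) i q hi hq (LinearMap.exact_iff.1 hiq).symm
  obtain ⟨s, hs⟩ := ((hiq.split_tfae hi hq).out 0 1).2 hr
  refine ⟨LinearMap.fst R E T ∘ₗ P.subtype ∘ₗ s, ?_⟩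
  ext y
  have h1 := (hP (s y).1).1 (s y).2
  have h2 : (s y).1.2 = y := LinearMap.congr_fun hs y
  simp only [LinearMap.comp_apply, LinearMap.fst_apply, Submodule.subtype_apply]
  rw [h1, h2]

/-- Maps `A → T` extend along `A → T0` if the cokernel is in `add T`. -/
lemma extend_of_ext1 (hT : Ext1Vanish R T T) {A T0 T1 : Type} [AddCommGroup A] [Module R A]
    [AddCommGroup T0] [Module R T0] [AddCommGroup T1] [Module R T1]
    (f : A →ₗ[R] T0) (g : T0 →ₗ[R] T1) (hf : Injective f) (hg : Surjective g)
    (hfg : Exact f g) (h1 : InAddOf R T T1) (φ : A →ₗ[R] T) : ∃ u : T0 →ₗ[R] T, u ∘ₗ f = φ := by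
  -- the pushout
  let N : Submodule R (T0 × T) := LinearMap.range (f.prod (-φ))
  let i : T →ₗ[R] (T0 × T) ⧸ N := N.mkQ ∘ₗ LinearMap.inr R T0 T
  let j : T0 →ₗ[R] (T0 × T) ⧸ N := N.mkQ ∘ₗ LinearMap.inl R T0 T
  let p : (T0 × T) ⧸ N →ₗ[R] T1 := N.liftQ (g ∘ₗ LinearMap.fst R T0 T) (by
    rintro _ ⟨a, rfl⟩
    simp [hfg.apply_apply_eq_zero])
  have hp : ∀ a b, p (N.mkQ (a, b)) = g a := fun a b => rfl
  have hij : ∀ a, j (f a) = i (φ a) := by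
    intro a
    change N.mkQ (f a, 0) = N.mkQ (0, φ a)
    rw [← sub_eq_zero, ← map_sub, Submodule.mkQ_apply, Submodule.Quotient.mk_eq_zero]
    exact ⟨a, by simp⟩
  have hi : Injective i := by
    rw [← LinearMap.ker_eq_bot, LinearMap.ker_eq_bot']
    intro x hx
    have hx' : N.mkQ (0, x) = 0 := hx
    rw [Submodule.mkQ_apply, Submodule.Quotient.mk_eq_zero] at hx'
    obtain ⟨a, ha⟩ := hx'
    have ha1 : f a = 0 := congrArg Prod.fst ha
    have ha2 : (-φ) a = x := congrArg Prod.snd ha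
    have : a = 0 := hf (by simpa using ha1)
    rw [← ha2, this, map_zero]
  have hpS : Surjective p := by
    intro y
    obtain ⟨a, ha⟩ := hg y
    exact ⟨N.mkQ (a, 0), ha⟩
  have hip : Exact i p := by
    intro z
    constructor
    · obtain ⟨⟨a, b⟩, rfl⟩ := N.mkQ_surjective z
      intro h
      rw [hp] at h
      obtain ⟨c, rfl⟩ := (hfg _).1 h
      refine ⟨φ c + b, ?_⟩
      rw [map_add, ← hij]
      change N.mkQ (f c, 0) + N.mkQ (0, b) = _
      rw [← map_add]
      simp
    · rintro ⟨x, rfl⟩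
      exact map_zero g
  obtain ⟨m, π, σ, hπσ⟩ := h1
  have hl := fun k : Fin m =>
    lift_of_ext1 hT i p hi hpS hip (π ∘ₗ LinearMap.single R (fun _ => T) k)
  choose l hl using hl
  have hL : p ∘ₗ (LinearMap.lsum R (fun _ : Fin m => T) ℕ l) = π := by
    apply LinearMap.pi_ext'
    intro k
    rw [← hl k]
    ext x
    change p (LinearMap.lsum R (fun _ : Fin m => T) ℕ l (Pi.single k x)) = p (l k x)
    rw [LinearMap.lsum_piSingle]
  have hsec : ∃ s, p ∘ₗ s = LinearMap.id :=
    ⟨(LinearMap.lsum R (fun _ : Fin m => T) ℕ l) ∘ₗ σ, by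
      rw [← LinearMap.comp_assoc, hL, hπσ]⟩
  obtain ⟨r, hr⟩ := ((hip.split_tfae hi hpS).out 0 1).1 hsec
  refine ⟨r ∘ₗ j, ?_⟩
  ext a
  change r (j (f a)) = φ a
  rw [hij]
  exact LinearMap.congr_fun hr (φ a)


/-- `X` is a sum of images of maps from powers of `T`. -/
def GenBy (R : Type) [Ring R] (T X : Type) [AddCommGroup T] [Module R T]
    [AddCommGroup X] [Module R X] : Prop :=
  ∀ x : X, ∃ (m : ℕ) (v : (Fin m → T) →ₗ[R] X) (y : Fin m → T), v y = x

lemma exists_approx (k : Type) [CommRing k] [IsArtinianRing k] [Algebra k R] [Module.Finite k R]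
    [Module.Finite R T] [Module.Finite R X] (hX : GenBy R T X) :
    ∃ (n : ℕ) (q : (Fin n → T) →ₗ[R] X), Surjective q ∧
      ∀ h : T →ₗ[R] X, ∃ l : T →ₗ[R] (Fin n → T), q ∘ₗ l = h := by
  let : Module k T := Module.compHom T (algebraMap k R)
  let : Module k X := Module.compHom X (algebraMap k R)
  have : IsScalarTower k R T := ⟨fun a b c => by
    rw [Algebra.smul_def, mul_smul]; rfl⟩
  have : IsScalarTower k R X := ⟨fun a b c => by
    rw [Algebra.smul_def, mul_smul]; rfl⟩
  have : Module.Finite k X := Module.Finite.trans R X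
  have : SMulCommClass R k X := IsScalarTower.to_smulCommClass'
  have : SMulCommClass R k T := IsScalarTower.to_smulCommClass'
  obtain ⟨m, s, hs⟩ := Module.Finite.exists_fin (R := R) (M := T)
  let ev : (T →ₗ[R] X) →ₗ[k] (Fin m → X) :=
    { toFun := fun f i => f (s i)
      map_add' := fun f g => rfl
      map_smul' := fun c f => rfl }
  have hev : Injective ev := by
    intro f g h
    apply LinearMap.ext_on_range hs
    intro i
    exact congrFun h i
  have : IsNoetherian k X := isNoetherian_of_isNoetherianRing_of_finite k X
  have : Module.Finite k (T →ₗ[R] X) := Module.Finite.of_injective ev hev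
  obtain ⟨n, t, ht⟩ := Module.Finite.exists_fin (R := k) (M := T →ₗ[R] X)
  let q : (Fin n → T) →ₗ[R] X := ∑ i, t i ∘ₗ LinearMap.proj i
  have hq : ∀ y, q y = ∑ i, t i (y i) := by
    intro y; simp [q]
  have hlift : ∀ h : T →ₗ[R] X, ∃ l : T →ₗ[R] (Fin n → T), q ∘ₗ l = h := by
    intro h
    have hh : h ∈ Submodule.span k (Set.range t) := by rw [ht]; trivial
    obtain ⟨c, hc⟩ := (Submodule.mem_span_range_iff_exists_fun k).1 hh
    refine ⟨LinearMap.pi (fun i => c i • LinearMap.id), ?_⟩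
    ext x
    rw [LinearMap.comp_apply, hq, ← hc]
    simp only [LinearMap.pi_apply, LinearMap.smul_apply, LinearMap.id_apply, LinearMap.sum_apply]
    refine Finset.sum_congr rfl (fun i _ => ?_)
    rw [← algebraMap_smul R (c i) x, map_smul, algebraMap_smul]
  refine ⟨n, q, ?_, hlift⟩
  intro x
  obtain ⟨m, v, y, rfl⟩ := hX x
  choose l hl using fun i : Fin m => hlift (v ∘ₗ LinearMap.single R (fun _ => T) i)
  refine ⟨∑ i, l i (y i), ?_⟩
  rw [map_sum]
  have : ∀ i, q (l i (y i)) = v (Pi.single i (y i)) := fun i => LinearMap.congr_fun (hl i) (y i)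
  simp only [this]
  rw [← map_sum, Finset.univ_sum_single]

lemma lift_fin {n m : ℕ} {q : (Fin n → T) →ₗ[R] X}
    (hq : ∀ h : T →ₗ[R] X, ∃ l : T →ₗ[R] (Fin n → T), q ∘ₗ l = h) (v : (Fin m → T) →ₗ[R] X) :
    ∃ L : (Fin m → T) →ₗ[R] (Fin n → T), q ∘ₗ L = v := by
  choose l hl using fun i : Fin m => hq (v ∘ₗ LinearMap.single R (fun _ => T) i)
  refine ⟨LinearMap.lsum R (fun _ : Fin m => T) ℕ l, ?_⟩
  apply LinearMap.pi_ext'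
  intro k
  rw [← hl k]
  ext x : 1
  change q (LinearMap.lsum R (fun _ : Fin m => T) ℕ l (Pi.single k x)) = q (l k x)
  rw [LinearMap.lsum_piSingle]

lemma genBy_ker (hT : IsTilting R T) {n : ℕ} {q : (Fin n → T) →ₗ[R] X}
    (hq : ∀ h : T →ₗ[R] X, ∃ l : T →ₗ[R] (Fin n → T), q ∘ₗ l = h) :
    GenBy R T (LinearMap.ker q) := by
  obtain ⟨-, hE, T0, T1, f, g, ⟨m0, π0, σ0, h0⟩, hT1, hf, hg, hfg⟩ := hT
  have hfg' : Exact f g := LinearMap.exact_iff.2 hfg.symm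
  rintro ⟨x, hx⟩
  choose u0 hu0 using fun i : Fin n =>
    extend_of_ext1 hE f g hf hg hfg' hT1 (LinearMap.toSpanSingleton R T (x i))
  let u : T0 →ₗ[R] (Fin n → T) := LinearMap.pi u0
  have hu : ∀ a, u (f a) = a • x := by
    intro a
    ext i
    exact LinearMap.congr_fun (hu0 i) a
  have hw : ∃ w : T1 →ₗ[R] X, w ∘ₗ g = q ∘ₗ u := by
    let e := g.quotKerEquivOfSurjective hg
    refine ⟨(LinearMap.ker g).liftQ (q ∘ₗ u) ?_ ∘ₗ e.symm.toLinearMap, ?_⟩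
    · rw [← hfg]
      rintro _ ⟨a, rfl⟩
      have : q x = 0 := hx
      simp [hu, this]
    · ext y
      have : e.symm (g y) = (LinearMap.ker g).mkQ y := by
        rw [LinearEquiv.symm_apply_eq]; rfl
      simp only [LinearMap.comp_apply, LinearEquiv.coe_coe, this]
      rfl
  obtain ⟨w, hw⟩ := hw
  obtain ⟨m1, π, σ, hπ⟩ := hT1
  obtain ⟨L, hL⟩ := lift_fin hq (w ∘ₗ π)
  let u' : T0 →ₗ[R] (Fin n → T) := u - L ∘ₗ σ ∘ₗ g
  have hu' : ∀ y, u' y ∈ LinearMap.ker q := by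
    intro y
    have h1 : q (L (σ (g y))) = w (π (σ (g y))) := LinearMap.congr_fun hL _
    have h2 : π (σ (g y)) = g y := LinearMap.congr_fun hπ _
    have h3 : w (g y) = q (u y) := LinearMap.congr_fun hw y
    rw [LinearMap.mem_ker]
    simp only [u', LinearMap.sub_apply, LinearMap.comp_apply, map_sub, h1, h2, h3, sub_self]
  refine ⟨m0, LinearMap.codRestrict _ u' hu' ∘ₗ π0, σ0 (f 1), ?_⟩
  apply Subtype.ext
  have h2 : π0 (σ0 (f 1)) = f 1 := LinearMap.congr_fun h0 _
  change u' (π0 (σ0 (f 1))) = x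
  rw [h2]
  simp [u', hu, hfg'.apply_apply_eq_zero]

/-- If `pd X ≤ 1`, then any epimorphism onto `X` with kernel a quotient of an injective splits. -/
lemma split_of_pd_one {Y I : Type} [AddCommGroup Y] [Module R Y] [AddCommGroup I] [Module R I]
    (hX : PDLT R 2 X) (q : Y →ₗ[R] X) (hq : Surjective q) (hI : Module.Injective R I)
    (p : I →ₗ[R] LinearMap.ker q) (hp : Surjective p) : ∃ s : X →ₗ[R] Y, q ∘ₗ s = LinearMap.id := by
  let P := X →₀ R
  let g : P →ₗ[R] X := Finsupp.linearCombination R id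
  have hg : Surjective g := Finsupp.linearCombination_id_surjective R X
  have hP : Module.Projective R P := inferInstance
  have hK : Module.Projective R (LinearMap.ker g) :=
    pdlt_one_iff.1 (pdlt_1 (Submodule.subtype_injective _) hg (exact_ker g)
      (pdlt_of_proj hP) hX)
  obtain ⟨a, ha⟩ := Module.projective_lifting_property q g hq
  have ha' : ∀ z, q (a z) = g z := fun z => LinearMap.congr_fun ha z
  let b : LinearMap.ker g →ₗ[R] LinearMap.ker q :=
    LinearMap.codRestrict _ (a ∘ₗ (LinearMap.ker g).subtype) (by
      rintro ⟨z, hz⟩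
      rw [LinearMap.mem_ker]
      exact (ha' z).trans hz)
  obtain ⟨c, hc⟩ := Module.projective_lifting_property p b hp
  obtain ⟨e, he⟩ := hI.out (X := LinearMap.ker g) (Y := P) (LinearMap.ker g).subtype (Submodule.subtype_injective _) c
  let a' : P →ₗ[R] Y := a - (LinearMap.ker q).subtype ∘ₗ p ∘ₗ e
  have hazero : LinearMap.ker g ≤ LinearMap.ker a' := by
    intro z hz
    have h1 : e z = c ⟨z, hz⟩ := he ⟨z, hz⟩
    have h2 : p (c ⟨z, hz⟩) = b ⟨z, hz⟩ := LinearMap.congr_fun hc _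
    rw [LinearMap.mem_ker]
    simp only [a', LinearMap.sub_apply, LinearMap.comp_apply, h1, h2]
    exact sub_self _
  have hqa : ∀ z, q (a' z) = g z := by
    intro z
    have : q ((p (e z) : LinearMap.ker q) : Y) = 0 := (p (e z)).2
    simp only [a', LinearMap.sub_apply, LinearMap.comp_apply, map_sub, ha', Submodule.subtype_apply,
      this, sub_zero]
  let ε := g.quotKerEquivOfSurjective hg
  refine ⟨(LinearMap.ker g).liftQ a' hazero ∘ₗ ε.symm.toLinearMap, ?_⟩
  ext x
  obtain ⟨y, rfl⟩ := hg x
  have : ε.symm (g y) = (LinearMap.ker g).mkQ y := by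
    rw [LinearEquiv.symm_apply_eq]; rfl
  simp only [LinearMap.comp_apply, LinearEquiv.coe_coe, this]
  exact hqa y

/-! The functor `Hom(T, -)`. -/

/-- Postcomposition. -/
def homMap (T : Type) [AddCommGroup T] [Module R T] (q : X →ₗ[R] Y) :
    (T →ₗ[R] X) →ₗ[(Module.End R T)ᵐᵒᵖ] (T →ₗ[R] Y) where
  toFun f := q ∘ₗ f
  map_add' f g := by ext; simp
  map_smul' b f := by
    simp only [endOp_smul_def, RingHom.id_apply, LinearMap.comp_assoc]

/-- `Hom(T, Tⁿ) ≅ Bⁿ`. -/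
def homPow (n : ℕ) : (Fin n → (Module.End R T)ᵐᵒᵖ) ≃ₗ[(Module.End R T)ᵐᵒᵖ]
    (T →ₗ[R] (Fin n → T)) where
  toFun b := LinearMap.pi (fun i => (b i).unop)
  invFun f i := MulOpposite.op (LinearMap.proj i ∘ₗ f)
  map_add' b c := by ext; simp
  map_smul' b c := by ext; simp [endOp_smul_def]
  left_inv b := by ext; simp
  right_inv f := by ext; simp

/-- Left exactness. -/
def homKer (q : X →ₗ[R] Y) : (T →ₗ[R] LinearMap.ker q) ≃ₗ[(Module.End R T)ᵐᵒᵖ]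
    LinearMap.ker (homMap T q) where
  toFun f := ⟨homMap T (LinearMap.ker q).subtype f, by
    rw [LinearMap.mem_ker]
    ext t
    exact (f t).2⟩
  invFun f := LinearMap.codRestrict _ f.1 (fun t => by
    have h : homMap T q f.1 = 0 := f.2
    exact LinearMap.congr_fun h t)
  map_add' f g := by apply Subtype.ext; exact map_add _ f g
  map_smul' b f := by apply Subtype.ext; exact map_smul _ b f
  left_inv f := by ext; rfl
  right_inv f := by apply Subtype.ext; ext; rfl

lemma proj_homPow (n : ℕ) : Module.Projective (Module.End R T)ᵐᵒᵖ (T →ₗ[R] (Fin n → T)) :=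
  Module.Projective.of_equiv (homPow n)

lemma finite_homPow (n : ℕ) : Module.Finite (Module.End R T)ᵐᵒᵖ (T →ₗ[R] (Fin n → T)) :=
  Module.Finite.equiv (homPow n)


lemma claimA (k : Type) [CommRing k] [IsArtinianRing k] [Algebra k R] [Module.Finite k R]
    [Module.Finite R T] (hT : IsTilting R T)
    (hG : GenByProjInj R T) (n : ℕ) :
    ∀ X : ModuleCat.{0} R, Module.Finite R X → GenBy R T X → PDLT R (n + 2) X →
      pdLE (Module.End R T)ᵐᵒᵖ n (T →ₗ[R] X) := by
  have : IsNoetherianRing R := IsNoetherianRing.of_finite k R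
  induction n with
  | zero =>
    intro X _ hX hpd
    obtain ⟨n, q, hq, hl⟩ := exists_approx k hX
    obtain ⟨N, p, hp, -⟩ := exists_approx k (genBy_ker hT hl)
    obtain ⟨Q, -, ⟨-, hQ⟩, r, hr⟩ := hG
    have hI : Module.Injective R (Fin N → Q) := inferInstance
    obtain ⟨s, hs⟩ := split_of_pd_one hpd q hq hI
      (p ∘ₗ LinearMap.pi (fun i => r ∘ₗ LinearMap.proj i)) (hp.comp (by
        intro y
        choose z hz using fun i => hr (y i)
        exact ⟨z, funext hz⟩))
    have := proj_homPow (R := R) (T := T) n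
    refine Module.Projective.of_split (homMap T s) (homMap T q) ?_
    ext f t
    exact LinearMap.congr_fun hs (f t)
  | succ n ih =>
    intro X _ hX hpd
    obtain ⟨m, q, hq, hl⟩ := exists_approx k hX
    refine ⟨ModuleCat.of _ (T →ₗ[R] (Fin m → T)), homMap T q, proj_homPow m, finite_homPow m,
      hl, ?_⟩
    refine pdLEcat_of_equiv n (ModuleCat.of _ (T →ₗ[R] LinearMap.ker q)) _ (homKer q) ?_
    refine ih (ModuleCat.of R (LinearMap.ker q)) ?_ (genBy_ker hT hl) ?_
    · change Module.Finite R (LinearMap.ker q); infer_instance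
    · refine pdlt_1 (Submodule.subtype_injective _) hq (exact_ker q) ?_ hpd
      exact pdlt_mono (by omega) (pdlt_fin (pdlt_of_pdLE hT.1) m)

lemma claimB (k : Type) [CommRing k] [IsArtinianRing k] [Algebra k R] [Module.Finite k R]
    [Module.Finite R T] (hT : IsTilting R T)
    (n : ℕ) :
    ∀ X : ModuleCat.{0} R, Module.Finite R X → GenBy R T X →
      PDLT (Module.End R T)ᵐᵒᵖ (n + 1) (T →ₗ[R] X) → PDLT R (n + 2) X := by
  have : IsNoetherianRing R := IsNoetherianRing.of_finite k R
  induction n with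
  | zero =>
    intro X _ hX hpd
    obtain ⟨m, q, hq, hl⟩ := exists_approx k hX
    have hK := genBy_ker hT hl
    have hproj := pdlt_one_iff.1 hpd
    have hsur : Surjective (homMap T q) := hl
    obtain ⟨σ, hσ⟩ := Module.projective_lifting_property (homMap T q) LinearMap.id hsur
    have hσ' : ∀ h : T →ₗ[R] X, q ∘ₗ σ h = h := fun h => LinearMap.congr_fun hσ h
    -- the idempotent of `Tᵐ` given by `σ ∘ Hom(T, q)`
    let ι := fun i : Fin m => LinearMap.single R (fun _ : Fin m => T) i
    let e : (Fin m → T) →ₗ[R] (Fin m → T) :=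
      LinearMap.lsum R (fun _ : Fin m => T) ℕ (fun i => σ (q ∘ₗ ι i))
    have heι : ∀ i, e ∘ₗ ι i = σ (q ∘ₗ ι i) := by
      intro i
      ext1 x
      change LinearMap.lsum R (fun _ : Fin m => T) ℕ _ (Pi.single i x) = _
      rw [LinearMap.lsum_piSingle]
    have heh : ∀ h : T →ₗ[R] (Fin m → T), e ∘ₗ h = σ (q ∘ₗ h) := by
      intro h
      have hh : h = ∑ i, ι i ∘ₗ (LinearMap.proj i ∘ₗ h) := by
        ext1 x
        simp only [LinearMap.sum_apply, LinearMap.comp_apply, LinearMap.proj_apply, ι]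
        exact (Finset.univ_sum_single (h x)).symm
      have hq : q ∘ₗ h = ∑ i, (MulOpposite.op (LinearMap.proj i ∘ₗ h) : (Module.End R T)ᵐᵒᵖ) •
          (q ∘ₗ ι i) := by
        conv_lhs => rw [hh]
        simp only [endOp_smul_def, MulOpposite.unop_op]
        ext1 x
        simp
      have hs : ∀ i, σ ((MulOpposite.op (LinearMap.proj i ∘ₗ h) : (Module.End R T)ᵐᵒᵖ) •
          (q ∘ₗ ι i)) = (e ∘ₗ ι i) ∘ₗ (LinearMap.proj i ∘ₗ h) := by
        intro i
        rw [heι]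
        exact σ.map_smul _ _
      rw [hq, map_sum, Finset.sum_congr rfl (fun i _ => hs i)]
      conv_lhs => rw [hh]
      ext1 x
      simp
    have hek : ∀ x ∈ LinearMap.ker q, e x = 0 := by
      intro x hx
      obtain ⟨N, v, y, hv⟩ := hK ⟨x, hx⟩
      have hx' : x = ∑ i, (v (Pi.single i (y i)) : LinearMap.ker q).1 := by
        rw [← Submodule.coe_sum, ← map_sum, Finset.univ_sum_single, hv]
      rw [hx', map_sum]
      refine Finset.sum_eq_zero (fun i _ => ?_)
      let h : T →ₗ[R] (Fin m → T) :=
        (LinearMap.ker q).subtype ∘ₗ v ∘ₗ LinearMap.single R (fun _ : Fin N => T) i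
      have hqh : q ∘ₗ h = 0 := by
        ext t
        exact (v _).2
      have := heh h
      rw [hqh, map_zero] at this
      exact LinearMap.congr_fun this (y i)
    have hqe : ∀ x, q (e x) = q x := by
      have : q ∘ₗ e = q := by
        apply LinearMap.pi_ext'
        intro i
        rw [LinearMap.comp_assoc]
        change q ∘ₗ (e ∘ₗ ι i) = _
        rw [heι, hσ']
      exact fun x => LinearMap.congr_fun this x
    let ε := q.quotKerEquivOfSurjective hq
    refine pdlt_of_retract q ((LinearMap.ker q).liftQ e hek ∘ₗ ε.symm.toLinearMap) ?_
      (pdlt_fin (pdlt_of_pdLE hT.1) m)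
    ext x
    obtain ⟨y, rfl⟩ := hq x
    have : ε.symm (q y) = (LinearMap.ker q).mkQ y := by
      rw [LinearEquiv.symm_apply_eq]; rfl
    simp only [LinearMap.comp_apply, LinearEquiv.coe_coe, this]
    exact hqe y
  | succ n ih =>
    intro X _ hX hpd
    obtain ⟨m, q, hq, hl⟩ := exists_approx k hX
    refine pdlt_3 (Submodule.subtype_injective _) hq (exact_ker q) ?_
      (pdlt_mono (by omega) (pdlt_fin (pdlt_of_pdLE hT.1) m))
    refine ih (ModuleCat.of R (LinearMap.ker q)) ?_ (genBy_ker hT hl) ?_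
    · change Module.Finite R (LinearMap.ker q); infer_instance
    · have hsur : Surjective (homMap T q) := hl
      have h1 : PDLT (Module.End R T)ᵐᵒᵖ (n + 1) (LinearMap.ker (homMap T q)) :=
        pdlt_1 (g := homMap T q) (Submodule.subtype_injective _) hsur (exact_ker (homMap T q))
          (pdlt_of_proj (proj_homPow m)) hpd
      exact pdlt_of_retract (homKer (T := T) q).symm.toLinearMap (homKer (T := T) q).toLinearMap
        (LinearEquiv.symm_comp (homKer (T := T) q)) h1

end Aux

theorem stmt17 (Λ : Type) [Ring Λ] (k : Type) [CommRing k] [IsArtinianRing k] [Algebra k Λ]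
    [Module.Finite k Λ]
    (hdom : DomdimGE2 Λ)
    (T : Type) [AddCommGroup T] [Module Λ T] [Module.Finite Λ T]
    (hT : IsTilting Λ T) (hTC : MemC Λ T)
    (M : Type) [AddCommGroup M] [Module Λ M] [Module.Finite Λ M]
    (hgen : ∃ (nn : ℕ) (q : (Fin nn → T) →ₗ[Λ] M), Surjective q)
    (d : ℕ) (hd : 1 ≤ d) (hpdle : pdLE Λ d M) (hpdge : ∀ m, pdLE Λ m M → d ≤ m) :
    pdLE ((Module.End Λ T)ᵐᵒᵖ) (d - 1) (T →ₗ[Λ] M) ∧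
    ∀ m, pdLE ((Module.End Λ T)ᵐᵒᵖ) m (T →ₗ[Λ] M) → d - 1 ≤ m := by 
  have hM : GenBy Λ T M := by
    obtain ⟨nn, q, hq⟩ := hgen
    intro x
    obtain ⟨y, hy⟩ := hq x
    exact ⟨nn, q, y, hy⟩
  have : IsNoetherianRing Λ := IsNoetherianRing.of_finite k Λ
  obtain ⟨n, rfl⟩ : ∃ n, d = n + 1 := ⟨d - 1, by omega⟩
  refine ⟨?_, fun m hm => ?_⟩
  · exact claimA k hT hTC.1 n (ModuleCat.of Λ M) ‹_› hM (pdlt_of_pdLE hpdle)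
  · have h := claimB k hT m (ModuleCat.of Λ M) ‹_› hM (pdlt_of_pdLE hm)
    have := hpdge (m + 1) (pdLEcat_of_pdlt (m + 1) (ModuleCat.of Λ M) ‹_› h)
    omega
end

section
/- Let Λ be a Cyclic-Nakayama algebra with n simple modules, Kupisch series (P_1,…,P_n) and admissible sequence c = (c_1,…,c_n) viewed as a function Z_n → Z with c_{i+1} ≤ c_i + 1 and c_i ≥ 2. Set Q_c = {i ∈ Z_n : c_{i+1} ≤ c_i} and P_c = {i ∈ Z_n : c_{i+1} = c_i + 1}. Then domdim Λ ≥ 2 if and only if P_c ⊆ {j − c_j ∈ Z_n : j ∈ Q_c}. -/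
open Function LinearMap

section Aux

variable {Λ : Type} [Ring Λ]

lemma inj_of_retr (M : Type) [AddCommGroup M] [Module Λ M] [Module.Finite Λ M]
    (H : ∀ (N : ModuleCat.{0} Λ) (f : M →ₗ[Λ] N), Module.Finite Λ N → Injective f →
      ∃ r : N →ₗ[Λ] M, ∀ x, r (f x) = x) : Module.Injective Λ M := by
  apply Module.Baer.injective
  intro I φ
  let W : Submodule Λ (M × Λ) := LinearMap.range (LinearMap.prod φ (-I.subtype))
  obtain ⟨r, hr⟩ := H (ModuleCat.of Λ ((M × Λ) ⧸ W)) (W.mkQ ∘ₗ LinearMap.inl Λ M Λ)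
    (inferInstanceAs (Module.Finite Λ ((M × Λ) ⧸ W))) (by
      rw [← LinearMap.ker_eq_bot, LinearMap.ker_eq_bot']
      intro m hm
      have hm' : ((m, 0) : M × Λ) ∈ W := by
        rw [← Submodule.Quotient.mk_eq_zero]
        exact hm
      obtain ⟨x, hx⟩ := hm'
      have h1 : φ x = m := congrArg Prod.fst hx
      have h2 : -(x : Λ) = 0 := congrArg Prod.snd hx
      have h3 : x = 0 := by
        apply Subtype.ext
        simpa using h2
      rw [← h1, h3, map_zero])
  refine ⟨r ∘ₗ W.mkQ ∘ₗ LinearMap.inr Λ M Λ, fun x hx => ?_⟩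
  have h := hr (φ ⟨x, hx⟩)
  rw [← h]
  change r (W.mkQ (0, x)) = r (W.mkQ (φ ⟨x, hx⟩, 0))
  congr 1
  symm
  apply (Submodule.Quotient.eq W).mpr
  exact ⟨⟨x, hx⟩, by simp⟩

lemma inj_of_summand {A B : Type} [AddCommGroup A] [Module Λ A] [AddCommGroup B] [Module Λ B]
    (s : A →ₗ[Λ] B) (r : B →ₗ[Λ] A) (h : ∀ x, r (s x) = x) (hB : Module.Injective Λ B) :
    Module.Injective Λ A := by
  constructor
  intro X Y _ _ _ _ f hf g
  obtain ⟨e, he⟩ := hB.out f hf (s ∘ₗ g)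
  exact ⟨r ∘ₗ e, fun x => by simp [he, h]⟩

lemma inj_prod {A B : Type} [AddCommGroup A] [Module Λ A] [AddCommGroup B] [Module Λ B]
    (hA : Module.Injective Λ A) (hB : Module.Injective Λ B) :
    Module.Injective Λ (A × B) := by
  constructor
  intro X Y _ _ _ _ f hf g
  obtain ⟨e, he⟩ := hA.out f hf (LinearMap.fst _ _ _ ∘ₗ g)
  obtain ⟨e', he'⟩ := hB.out f hf (LinearMap.snd _ _ _ ∘ₗ g)
  exact ⟨e.prod e', fun x => by ext <;> simp [he, he']⟩

lemma bij_of_surj {A B : Type} [AddCommGroup A] [Module Λ A] [AddCommGroup B] [Module Λ B]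
    (hA : Indecomposable Λ A) (hB : Indecomposable Λ B) (hp : Module.Projective Λ B)
    (σ : A →ₗ[Λ] B) (hσ : Surjective σ) : Bijective σ := by
  obtain ⟨s, hs⟩ := Module.projective_lifting_property σ LinearMap.id hσ
  have hs' : ∀ x, σ (s x) = x := fun x => LinearMap.congr_fun hs x
  rcases hA.2 (s ∘ₗ σ) (by ext x; simp [hs']) with h | h
  · obtain ⟨b, hb⟩ := hB.1
    exfalso
    apply hb
    have := LinearMap.congr_fun h (s b)
    simp only [LinearMap.comp_apply, hs', LinearMap.zero_apply] at this
    rw [← hs' b, this, map_zero]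
  · refine ⟨fun x y hxy => ?_, hσ⟩
    have h1 := LinearMap.congr_fun h x
    have h2 := LinearMap.congr_fun h y
    simp only [LinearMap.comp_apply, LinearMap.id_apply] at h1 h2
    rw [← h1, ← h2, hxy]

lemma indec_of_essential {M E : Type} [AddCommGroup M] [Module Λ M] [AddCommGroup E] [Module Λ E]
    (hM : Uniserial Λ M) (hM0 : ∃ x : M, x ≠ 0) (f : M →ₗ[Λ] E) (hf : Injective f)
    (hess : ∀ L : Submodule Λ E, L ⊓ LinearMap.range f = ⊥ → L = ⊥) : Indecomposable Λ E := by
  obtain ⟨x, hx⟩ := hM0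
  refine ⟨⟨f x, fun h => hx (hf (by simpa using h))⟩, fun e he => ?_⟩
  have he' : ∀ x, e (e x) = e x := fun x => LinearMap.congr_fun he x
  have key : ∀ y, e y = 0 → y ∈ LinearMap.range e → y = 0 := by
    rintro y hy ⟨z, rfl⟩
    rwa [he'] at hy
  rcases hM ((LinearMap.ker e).comap f) ((LinearMap.range e).comap f) with h | h
  · right
    have : LinearMap.ker e = ⊥ := by
      apply hess
      rw [eq_bot_iff]
      rintro _ ⟨hy, z, rfl⟩
      exact key _ hy (h (show z ∈ (LinearMap.ker e).comap f from hy))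
    ext y
    have h3 : e y - y ∈ LinearMap.ker e := by simp [he']
    rw [this, Submodule.mem_bot, sub_eq_zero] at h3
    exact h3
  · left
    have : LinearMap.range e = ⊥ := by
      apply hess
      rw [eq_bot_iff]
      rintro _ ⟨hy, z, rfl⟩
      exact key _ (h (show z ∈ (LinearMap.range e).comap f from hy)) hy
    exact LinearMap.range_eq_bot.mp this

lemma exists_uniform_quotient {M N : Type} [AddCommGroup M] [Module Λ M] [AddCommGroup N]
    [Module Λ N] [IsNoetherian Λ N]
    (hM : Uniserial Λ M) (hM0 : ∃ x : M, x ≠ 0) (f : M →ₗ[Λ] N) (hf : Injective f) :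
    ∃ K : Submodule Λ N, Injective (K.mkQ ∘ₗ f) ∧ Indecomposable Λ (N ⧸ K) := by
  obtain ⟨K, hK, hmax⟩ := WellFounded.has_min (wellFounded_gt (α := Submodule Λ N))
    {K | K ⊓ LinearMap.range f = ⊥} ⟨⊥, by simp⟩
  have hinj : Injective (K.mkQ ∘ₗ f) := by
    rw [← LinearMap.ker_eq_bot, LinearMap.ker_eq_bot']
    intro m hm
    have hm' : f m ∈ K := (Submodule.Quotient.mk_eq_zero K).mp hm
    have : f m ∈ K ⊓ LinearMap.range f := ⟨hm', m, rfl⟩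
    rw [hK, Submodule.mem_bot] at this
    exact hf (by simpa using this)
  refine ⟨K, hinj, indec_of_essential hM hM0 (K.mkQ ∘ₗ f) hinj ?_⟩
  intro L hL
  have hle : K ≤ L.comap K.mkQ := by
    intro y hy
    have : K.mkQ y = 0 := (Submodule.Quotient.mk_eq_zero K).mpr hy
    rw [Submodule.mem_comap, this]
    exact zero_mem _
  have hmem : L.comap K.mkQ ⊓ LinearMap.range f = ⊥ := by
    rw [eq_bot_iff]
    rintro _ ⟨hy, z, rfl⟩
    have : K.mkQ (f z) ∈ L ⊓ LinearMap.range (K.mkQ ∘ₗ f) := ⟨hy, z, rfl⟩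
    rw [hL, Submodule.mem_bot] at this
    have hz : z = 0 := hinj (by simpa using this)
    simp [hz]
  have heq : L.comap K.mkQ = K := by
    by_contra hne
    exact hmax _ hmem (lt_of_le_of_ne hle (Ne.symm hne))
  rw [eq_bot_iff]
  intro y hy
  obtain ⟨z, rfl⟩ := K.mkQ_surjective y
  have : z ∈ K := heq ▸ (show z ∈ L.comap K.mkQ from hy)
  exact (Submodule.Quotient.mk_eq_zero K).mpr this

lemma proj_induction [IsArtinianRing Λ] (C : ModuleCat.{0} Λ → Prop)
    (h0 : ∀ Q : ModuleCat.{0} Λ, Subsingleton Q → C Q)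
    (hi : ∀ Q : ModuleCat.{0} Λ, Module.Finite Λ Q → Module.Projective Λ Q →
      Indecomposable Λ Q → C Q)
    (hadd : ∀ Q A B : ModuleCat.{0} Λ, ((Q : Type) ≃ₗ[Λ] Prod (A : Type) (B : Type)) →
      C A → C B → C Q) :
    ∀ Q : ModuleCat.{0} Λ, Module.Finite Λ Q → Module.Projective Λ Q → C Q := by
  suffices H : ∀ (m : ℕ) (Q : ModuleCat.{0} Λ), Module.Finite Λ Q → Module.Projective Λ Q →
      Module.length Λ Q < m → C Q by
    intro Q hf hp
    have : Module.length Λ Q ≠ ⊤ := Module.length_ne_top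
    obtain ⟨m, hm⟩ := ENat.ne_top_iff_exists.mp this
    refine H (m + 1) Q hf hp ?_
    rw [← hm]
    exact_mod_cast Nat.lt_succ_self m
  intro m
  induction m with
  | zero => intro Q _ _ h; simp at h
  | succ m ih =>
    intro Q hf hp hlt
    by_cases hs : Subsingleton Q
    · exact h0 Q hs
    by_cases hI : Indecomposable Λ Q
    · exact hi Q hf hp hI
    have hnt : Nontrivial Q := not_subsingleton_iff_nontrivial.mp hs
    have : ∃ e : Q →ₗ[Λ] Q, e ∘ₗ e = e ∧ e ≠ 0 ∧ e ≠ LinearMap.id := by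
      by_contra hcon
      push Not at hcon
      refine hI ⟨exists_ne 0, fun e he => ?_⟩
      by_cases h : e = 0
      · exact Or.inl h
      · exact Or.inr (hcon e he h)
    obtain ⟨e, he, he0, he1⟩ := this
    have he' : ∀ x, e (e x) = e x := fun x => LinearMap.congr_fun he x
    let A := LinearMap.range e
    let B := LinearMap.ker e
    let pA : Q →ₗ[Λ] A := e.rangeRestrict
    let pB : Q →ₗ[Λ] B := (LinearMap.id - e).codRestrict B (fun x => by simp [B, he'])
    have hA : A ≠ ⊤ := by
      intro h
      apply he1
      ext x
      obtain ⟨y, rfl⟩ : x ∈ A := h ▸ Submodule.mem_top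
      exact he' y
    have hB : B ≠ ⊤ := by
      intro h
      exact he0 (LinearMap.ker_eq_top.mp h)
    have hpA : Module.Projective Λ A := Module.Projective.of_split A.subtype pA (by
      ext ⟨x, y, rfl⟩
      simp [pA, he'])
    have hpB : Module.Projective Λ B := Module.Projective.of_split B.subtype pB (by
      ext ⟨x, hx⟩
      have : e x = 0 := hx
      simp [pB, this])
    have hlA := Submodule.length_lt hA
    have hlB := Submodule.length_lt hB
    have hle : Module.length Λ Q ≤ m := by
      apply Order.le_of_lt_add_one
      exact_mod_cast hlt
    refine hadd Q (ModuleCat.of Λ A) (ModuleCat.of Λ B) ?_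
      (ih _ (inferInstanceAs (Module.Finite Λ A)) hpA (lt_of_lt_of_le hlA hle))
      (ih _ (inferInstanceAs (Module.Finite Λ B)) hpB (lt_of_lt_of_le hlB hle))
    exact LinearEquiv.ofLinearMap (LinearMap.prod pA pB)
      (LinearMap.coprod A.subtype B.subtype)
      (by
        apply LinearMap.ext
        rintro ⟨⟨x, y, rfl⟩, ⟨z, hz⟩⟩
        have : e z = 0 := hz
        ext <;> simp [pA, pB, he', this])
      (by ext x; simp [pA, pB])

end Aux

section Aux2

lemma enat_cancel {a b c : ℕ∞} (ha : a ≠ ⊤) (h : a + b = a + c) : b = c :=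
  WithTop.add_left_cancel ha h

variable {Λ : Type} [Ring Λ]

lemma rad_facts (M : Type) [AddCommGroup M] [Module Λ M] [Module.Finite Λ M]
    (hM : Uniserial Λ M) (hM0 : ∃ x : M, x ≠ 0) :
    IsCoatom (radSub Λ M) ∧ ∀ N : Submodule Λ M, N ≠ ⊤ → N ≤ radSub Λ M := by
  have hnt : Nontrivial M := ⟨hM0.choose, 0, hM0.choose_spec⟩
  obtain ⟨K, hK, -⟩ := (eq_top_or_exists_le_coatom (⊥ : Submodule Λ M)).resolve_left bot_ne_top
  have huniq : ∀ L : Submodule Λ M, IsCoatom L → L = K := by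
    intro L hL
    rcases hM L K with h | h
    · exact ((hL.le_iff.mp h).resolve_left hK.1).symm
    · exact (hK.le_iff.mp h).resolve_left hL.1
  have hrad : radSub Λ M = K := by
    apply le_antisymm
    · exact sInf_le hK
    · apply le_sInf
      intro L hL
      exact (huniq L hL).ge
  rw [hrad]
  refine ⟨hK, fun N hN => ?_⟩
  obtain ⟨L, hL, hle⟩ := (eq_top_or_exists_le_coatom N).resolve_left hN
  exact huniq L hL ▸ hle

lemma length_coatom {M : Type} [AddCommGroup M] [Module Λ M] {K : Submodule Λ M}
    (hK : IsCoatom K) : Module.length Λ M = Module.length Λ K + 1 := by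
  rw [Module.length_eq_add_of_exact K.subtype K.mkQ K.subtype_injective K.mkQ_surjective
    (LinearMap.exact_subtype_mkQ K)]
  congr 1
  rw [Module.length_eq_one_iff, isSimpleModule_iff_isCoatom]
  exact hK

lemma length_ker_range {M E : Type} [AddCommGroup M] [Module Λ M] [AddCommGroup E] [Module Λ E]
    (h : M →ₗ[Λ] E) :
    Module.length Λ M = Module.length Λ (LinearMap.ker h) + Module.length Λ (LinearMap.range h) :=
  Module.length_eq_add_of_exact (LinearMap.ker h).subtype h.rangeRestrict
    (Submodule.subtype_injective _) h.surjective_rangeRestrict (by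
      intro x
      constructor
      · intro hx
        exact ⟨⟨x, by simpa using congrArg Subtype.val hx⟩, rfl⟩
      · rintro ⟨y, rfl⟩
        exact Subtype.ext y.2)

lemma length_map_coatom {M E : Type} [AddCommGroup M] [Module Λ M] [AddCommGroup E] [Module Λ E]
    (hfin : Module.length Λ M ≠ ⊤)
    {K : Submodule Λ M} (hK : IsCoatom K) (h : M →ₗ[Λ] E) (hker : LinearMap.ker h ≤ K) :
    Module.length Λ (LinearMap.range h) = Module.length Λ (K.map h) + 1 := by
  have h1 := length_ker_range h
  have h2 := length_ker_range (h ∘ₗ K.subtype)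
  have h3 := length_coatom hK
  have h4 : LinearMap.range (h ∘ₗ K.subtype) = K.map h := by
    rw [LinearMap.range_comp, Submodule.range_subtype]
  have h5 : Module.length Λ (LinearMap.ker (h ∘ₗ K.subtype)) =
      Module.length Λ (LinearMap.ker h) := by
    rw [LinearMap.ker_comp]
    exact (Submodule.comapSubtypeEquivOfLe hker).length_eq
  rw [h4, h5] at h2
  have h6 : Module.length Λ (LinearMap.ker h) ≠ ⊤ := by
    intro h
    rw [h] at h1
    simp at h1
    exact hfin h1
  rw [h3, h2, add_assoc] at h1
  exact (enat_cancel h6 h1).symm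

end Aux2

/-- The data of a cyclic Nakayama algebra. -/
structure NakSetup (Λ : Type) [Ring Λ] (n : ℕ) [NeZero n] (P : ZMod n → ModuleCat.{0} Λ)
    (c : ZMod n → ℕ) : Prop where
  art : IsArtinianRing Λ
  fg : ∀ i, Module.Finite Λ (P i)
  proj : ∀ i, Module.Projective Λ (P i)
  ind : ∀ i, Indecomposable Λ (P i)
  iso : ∀ i j, Nonempty ((P i : Type) ≃ₗ[Λ] (P j : Type)) → i = j
  all : ∀ M : ModuleCat.{0} Λ, Module.Finite Λ M → Module.Projective Λ M →
      Indecomposable Λ M → ∃ i, Nonempty ((M : Type) ≃ₗ[Λ] (P i : Type))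
  nak : ∀ M : ModuleCat.{0} Λ, Module.Finite Λ M → Indecomposable Λ M → Uniserial Λ M
  len : ∀ i, Module.length Λ (P i) = c i
  c2 : ∀ i, 2 ≤ c i
  csucc : ∀ i, c (i + 1) ≤ c i + 1
  exπ : ∀ i, ∃ f : (P i : Type) →ₗ[Λ] (P (i + 1) : Type),
    LinearMap.range f = radSub Λ (P (i + 1) : Type)

namespace NakSetup

variable {Λ : Type} [Ring Λ] {n : ℕ} [NeZero n] {P : ZMod n → ModuleCat.{0} Λ}
    {c : ZMod n → ℕ}

lemma uni (S : NakSetup Λ n P c) (i : ZMod n) : Uniserial Λ (P i) := S.nak _ (S.fg i) (S.ind i)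

lemma radCoatom (S : NakSetup Λ n P c) (i : ZMod n) : IsCoatom (radSub Λ (P i : Type)) :=
  have := S.fg i
  (rad_facts (P i : Type) (S.uni i) (S.ind i).1).1

lemma le_rad (S : NakSetup Λ n P c) (i : ZMod n) (N : Submodule Λ (P i : Type)) (h : N ≠ ⊤) : N ≤ radSub Λ (P i : Type) :=
  have := S.fg i
  (rad_facts (P i : Type) (S.uni i) (S.ind i).1).2 N h

lemma eq_top_of (S : NakSetup Λ n P c) (i : ZMod n) (N : Submodule Λ (P i : Type)) (h : ¬ N ≤ radSub Λ (P i : Type)) :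
    N = ⊤ := by
  by_contra hN
  exact h (S.le_rad i N hN)

lemma len_rad (S : NakSetup Λ n P c) (i : ZMod n) : Module.length Λ (radSub Λ (P i : Type)) + 1 = c i := by
  rw [← S.len i, length_coatom (S.radCoatom i)]

lemma len_ne_top (S : NakSetup Λ n P c) (i : ZMod n) : Module.length Λ (P i) ≠ ⊤ := by
  rw [S.len]; exact ENat.natCast_ne_top _

lemma π_inj_iff (S : NakSetup Λ n P c) (i : ZMod n) (f : (P i : Type) →ₗ[Λ] (P (i + 1) : Type))
    (hf : LinearMap.range f = radSub Λ (P (i + 1) : Type)) :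
    Injective f ↔ c (i + 1) = c i + 1 := by
  have h1 := length_ker_range f
  have h2 := S.len_rad (i + 1)
  rw [hf, S.len] at h1
  have h3 : Module.length Λ (radSub Λ (P (i+1) : Type)) ≠ ⊤ := by
    intro h; rw [h] at h2; simp at h2
  have h4 : Module.length Λ (LinearMap.ker f) ≠ ⊤ := by
    intro h; rw [h] at h1; simp at h1
  have h5 : Injective f ↔ Module.length Λ (LinearMap.ker f) = 0 := by
    rw [← LinearMap.ker_eq_bot, Module.length_eq_zero_iff, Submodule.subsingleton_iff_eq_bot]
  rw [h5]
  obtain ⟨a, ha⟩ := ENat.ne_top_iff_exists.mp h3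
  obtain ⟨b, hb⟩ := ENat.ne_top_iff_exists.mp h4
  rw [← ha] at h1 h2
  rw [← hb] at h1 ⊢
  norm_cast at h1 h2 ⊢
  omega

lemma iso_of_surj (S : NakSetup Λ n P c) {i j : ZMod n} (f : (P i : Type) →ₗ[Λ] (P j : Type)) (hf : Surjective f) :
    i = j ∧ Bijective f :=
  have hb := bij_of_surj (S.ind i) (S.ind j) (S.proj j) f hf
  ⟨S.iso i j ⟨LinearEquiv.ofBijective f hb⟩, hb⟩

/-- A map whose image is not contained in `N` yields one from an indecomposable projective. -/
lemma exists_cover (S : NakSetup Λ n P c) (E : Type) [AddCommGroup E] [Module Λ E] (N : Submodule Λ E) :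
    ∀ Q : ModuleCat.{0} Λ, Module.Finite Λ Q → Module.Projective Λ Q →
      ∀ φ : Q →ₗ[Λ] E, ¬ LinearMap.range φ ≤ N →
        ∃ (l : ZMod n) (ψ : (P l : Type) →ₗ[Λ] E), LinearMap.range ψ ≤ LinearMap.range φ ∧
          ¬ LinearMap.range ψ ≤ N := by
  have := S.art
  apply proj_induction
  · intro Q hQ φ hφ
    exfalso
    apply hφ
    rintro _ ⟨x, rfl⟩
    rw [Subsingleton.elim x 0, map_zero]
    exact zero_mem _
  · intro Q hf hp hi φ hφ
    obtain ⟨l, ⟨e⟩⟩ := S.all Q hf hp hi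
    have : LinearMap.range (φ ∘ₗ e.symm.toLinearMap) = LinearMap.range φ := by
      rw [LinearMap.range_comp, LinearEquiv.range, Submodule.map_top]
    exact ⟨l, φ ∘ₗ e.symm.toLinearMap, this.le, by rwa [this]⟩
  · intro Q A B e hA hB φ hφ
    let a := φ ∘ₗ e.symm.toLinearMap ∘ₗ LinearMap.inl Λ A B
    let b := φ ∘ₗ e.symm.toLinearMap ∘ₗ LinearMap.inr Λ A B
    have ha : LinearMap.range a ≤ LinearMap.range φ := LinearMap.range_comp_le_range _ _
    have hb : LinearMap.range b ≤ LinearMap.range φ := LinearMap.range_comp_le_range _ _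
    by_cases h1 : LinearMap.range a ≤ N
    · by_cases h2 : LinearMap.range b ≤ N
      · exfalso
        apply hφ
        rintro _ ⟨x, rfl⟩
        have : φ x = a (e x).1 + b (e x).2 := by
          simp only [a, b, LinearMap.comp_apply, LinearEquiv.coe_coe]
          rw [← map_add, ← map_add]
          simp
        rw [this]
        exact add_mem (h1 ⟨_, rfl⟩) (h2 ⟨_, rfl⟩)
      · obtain ⟨l, ψ, h, h'⟩ := hB b h2
        exact ⟨l, ψ, h.trans hb, h'⟩
    · obtain ⟨l, ψ, h, h'⟩ := hA a h1
      exact ⟨l, ψ, h.trans ha, h'⟩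

lemma surj_into_uniserial (S : NakSetup Λ n P c) (i : ZMod n) (hi : c (i + 1) ≤ c i) (E : Type) [AddCommGroup E]
    [Module Λ E] [Module.Finite Λ E] (hE : Uniserial Λ E) (f : (P i : Type) →ₗ[Λ] E)
    (hf : Injective f) : Surjective f := by
  have := S.art
  by_contra hns
  have hnt : LinearMap.range f ≠ ⊤ := fun h => hns (LinearMap.range_eq_top.mp h)
  obtain ⟨M, hcov⟩ := exists_covBy_of_wellFoundedLT (a := LinearMap.range f)
    (by rwa [isMax_iff_eq_top])
  obtain ⟨x, hxM, hxF⟩ := SetLike.exists_of_lt hcov.lt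
  obtain ⟨l, ψ, h1, h2⟩ := S.exists_cover E (LinearMap.range f) (ModuleCat.of Λ Λ)
    (inferInstanceAs (Module.Finite Λ Λ)) (inferInstanceAs (Module.Projective Λ Λ))
    (LinearMap.toSpanSingleton Λ E x) (fun h => hxF (h ⟨1, by simp⟩))
  have h3 : LinearMap.range ψ ≤ M := by
    refine h1.trans ?_
    rintro _ ⟨r, rfl⟩
    exact M.smul_mem r hxM
  have hlt : LinearMap.range f < LinearMap.range ψ :=
    lt_of_le_not_ge ((hE _ _).resolve_left h2) h2
  have hψM : LinearMap.range ψ = M := eq_of_le_of_not_lt h3 (hcov.2 hlt) 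
  obtain ⟨l', rfl⟩ : ∃ l', l = l' + 1 := ⟨l - 1, by ring⟩
  obtain ⟨π, hπ⟩ := S.exπ l'
  have h4 : (LinearMap.range f).comap ψ ≤ radSub Λ (P (l' + 1) : Type) := by
    apply S.le_rad
    intro h
    apply h2
    rintro _ ⟨y, rfl⟩
    exact (h ▸ Submodule.mem_top : y ∈ (LinearMap.range f).comap ψ)
  have h5 : LinearMap.range (ψ ∘ₗ π) = LinearMap.range f := by
    rw [LinearMap.range_comp, hπ]
    have hle : LinearMap.range f ≤ (radSub Λ (P (l' + 1) : Type)).map ψ := by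
      intro y hy
      obtain ⟨z, rfl⟩ := hlt.le hy
      exact ⟨z, h4 hy, rfl⟩
    by_contra hne
    have hlt2 := lt_of_le_of_ne hle (Ne.symm hne)
    have heq := eq_of_le_of_not_lt (by rw [← hψM]; exact LinearMap.map_le_range) (hcov.2 hlt2)
    apply (S.radCoatom (l' + 1)).1
    rw [eq_top_iff]
    intro y _
    have : ψ y ∈ (radSub Λ (P (l' + 1) : Type)).map ψ := by
      rw [heq, ← hψM]; exact ⟨y, rfl⟩
    obtain ⟨z, hz, hzy⟩ := this
    have h6 : y - z ∈ radSub Λ (P (l' + 1) : Type) := by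
      apply h4
      rw [Submodule.mem_comap, map_sub, hzy, sub_self]
      exact zero_mem _
    simpa using add_mem h6 hz
  let F := LinearEquiv.ofInjective f hf
  let σ : (P l' : Type) →ₗ[Λ] (P i : Type) := F.symm.toLinearMap ∘ₗ
    (ψ ∘ₗ π).codRestrict (LinearMap.range f) (fun x => h5 ▸ ⟨x, rfl⟩)
  have hfσ : ∀ x, f (σ x) = ψ (π x) := by
    intro x
    have : F (σ x) = (ψ ∘ₗ π).codRestrict (LinearMap.range f) (fun x => h5 ▸ ⟨x, rfl⟩) x := by
      simp [σ]
    exact congrArg Subtype.val this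
  have hσ : Surjective σ := by
    intro y
    have : f y ∈ LinearMap.range (ψ ∘ₗ π) := h5 ▸ ⟨y, rfl⟩
    obtain ⟨x, hx⟩ := this
    exact ⟨x, hf (by rw [hfσ]; exact hx)⟩
  obtain ⟨rfl, hb⟩ := S.iso_of_surj σ hσ
  have hπi : Injective π := by
    intro x y hxy
    apply hb.1
    apply hf
    rw [hfσ, hfσ, hxy]
  have := (S.π_inj_iff l' π hπ).mp hπi
  omega

lemma injective_of_le (S : NakSetup Λ n P c) (i : ZMod n) (hi : c (i + 1) ≤ c i) : Module.Injective Λ (P i) := by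
  have := S.art
  have := S.fg i
  apply inj_of_retr
  intro N f hN hf
  obtain ⟨K, hK, hind⟩ := exists_uniform_quotient (S.uni i) (S.ind i).1 f hf
  have hu : Uniserial Λ (N ⧸ K) := S.nak (ModuleCat.of Λ (N ⧸ K))
    (inferInstanceAs (Module.Finite Λ (N ⧸ K))) hind
  have hs := S.surj_into_uniserial i hi (N ⧸ K) hu (K.mkQ ∘ₗ f) hK
  let F := LinearEquiv.ofBijective (K.mkQ ∘ₗ f) ⟨hK, hs⟩
  exact ⟨F.symm.toLinearMap ∘ₗ K.mkQ, fun x => F.symm_apply_apply x⟩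

lemma le_of_injective (S : NakSetup Λ n P c) (i : ZMod n) (hi : Module.Injective Λ (P i)) : c (i + 1) ≤ c i := by
  by_contra hlt
  have hc : c (i + 1) = c i + 1 := by have := S.csucc i; omega
  obtain ⟨π, hπ⟩ := S.exπ i
  have hinj := (S.π_inj_iff i π hπ).mpr hc
  obtain ⟨r, hr⟩ := hi.out π hinj LinearMap.id
  simp only [LinearMap.id_apply] at hr
  rcases (S.ind (i + 1)).2 (π ∘ₗ r) (by ext x; simp [hr]) with h | h
  · obtain ⟨x, hx⟩ := (S.ind i).1
    apply hx
    apply hinj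
    have := LinearMap.congr_fun h (π x)
    simpa [hr] using this
  · apply (S.radCoatom (i + 1)).1
    rw [← hπ, eq_top_iff]
    intro x _
    exact ⟨r x, LinearMap.congr_fun h x⟩

/-- Maps onto the radical powers. -/
lemma exists_power (S : NakSetup Λ n P c) (j : ZMod n) : ∀ t : ℕ, t < c j → ∃ a : ZMod n, a + (t : ZMod n) = j ∧
    ∃ h : (P a : Type) →ₗ[Λ] (P j : Type),
      Module.length Λ (LinearMap.range h) + t = c j := by
  intro t
  induction t with
  | zero =>
    intro _
    refine ⟨j, by simp, LinearMap.id, ?_⟩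
    rw [LinearMap.range_id, Module.length_top, S.len]
    simp
  | succ t ih =>
    intro ht
    obtain ⟨a, ha, h, hh⟩ := ih (by omega)
    obtain ⟨a, rfl⟩ : ∃ a', a = a' + 1 := ⟨a - 1, by ring⟩
    obtain ⟨π, hπ⟩ := S.exπ a
    refine ⟨a, by rw [← ha]; push_cast; ring, h ∘ₗ π, ?_⟩
    rw [LinearMap.range_comp, hπ]
    have hker : LinearMap.ker h ≤ radSub Λ (P (a + 1) : Type) := by
      apply S.le_rad
      intro hk
      rw [LinearMap.ker_eq_top.mp hk, LinearMap.range_zero, Module.length_bot] at hh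
      norm_cast at hh
      omega
    rw [length_map_coatom (S.len_ne_top _) (S.radCoatom _) h hker] at hh
    rw [← hh]
    push_cast
    ring

/-- The map onto the socle. -/
lemma exists_socle (S : NakSetup Λ n P c) (j : ZMod n) : ∃ a : ZMod n, a + (c j : ZMod n) = j + 1 ∧
    ∃ h : (P a : Type) →ₗ[Λ] (P j : Type), LinearMap.ker h = radSub Λ (P a : Type) := by
  obtain ⟨t, ht⟩ : ∃ t, c j = t + 1 := ⟨c j - 1, by have := S.c2 j; omega⟩
  obtain ⟨a, ha, h, hh⟩ := S.exists_power j t (by omega)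
  refine ⟨a, by rw [ht, ← ha]; push_cast; ring, h, ?_⟩
  have hr : Module.length Λ (LinearMap.range h) = 1 := by
    rw [ht] at hh
    push_cast at hh
    rw [add_comm] at hh
    exact enat_cancel (ENat.natCast_ne_top t) hh
  have hker : LinearMap.ker h ≤ radSub Λ (P a : Type) := by
    apply S.le_rad
    intro hk
    rw [LinearMap.ker_eq_top.mp hk, LinearMap.range_zero, Module.length_bot] at hr
    simp at hr
  apply le_antisymm hker
  rw [length_map_coatom (S.len_ne_top _) (S.radCoatom _) h hker] at hr
  have h0 : Module.length Λ ((radSub Λ (P a : Type)).map h) = 0 := by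
    simpa using hr
  rw [Module.length_eq_zero_iff, Submodule.subsingleton_iff_eq_bot] at h0
  exact LinearMap.le_ker_iff_map.mpr h0

lemma lift_aux (S : NakSetup Λ n P c) {a b j : ZMod n} (φ : (P a : Type) →ₗ[Λ] (P j : Type))
    (h : (P b : Type) →ₗ[Λ] (P j : Type)) (hφ : φ ≠ 0)
    (hh : LinearMap.ker h = radSub Λ (P b : Type))
    (hle : LinearMap.range φ ≤ LinearMap.range h) : a = b := by
  have := S.proj a
  obtain ⟨θ, hθ⟩ := Module.projective_lifting_property h.rangeRestrict
    (φ.codRestrict (LinearMap.range h) (fun x => hle ⟨x, rfl⟩)) h.surjective_rangeRestrict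
  have hθ' : ∀ x, h (θ x) = φ x := fun x => congrArg Subtype.val (LinearMap.congr_fun hθ x)
  refine (S.iso_of_surj θ ?_).1
  rw [← LinearMap.range_eq_top]
  apply S.eq_top_of
  intro hθr
  apply hφ
  ext x
  rw [← hθ']
  have : θ x ∈ LinearMap.ker h := hh ▸ hθr ⟨x, rfl⟩
  exact this

lemma socle_unique (S : NakSetup Λ n P c) {a b j : ZMod n} (φ : (P a : Type) →ₗ[Λ] (P j : Type))
    (h : (P b : Type) →ₗ[Λ] (P j : Type)) 
    (hφ : LinearMap.ker φ = radSub Λ (P a : Type))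
    (hh : LinearMap.ker h = radSub Λ (P b : Type)) : a = b := by
  have h1 : φ ≠ 0 := by
    rintro rfl
    exact (S.radCoatom a).1 (by rw [← hφ, LinearMap.ker_zero])
  have h2 : h ≠ 0 := by
    rintro rfl
    exact (S.radCoatom b).1 (by rw [← hh, LinearMap.ker_zero])
  rcases S.uni j (LinearMap.range φ) (LinearMap.range h) with hle | hle
  · exact S.lift_aux φ h h1 hh hle
  · exact (S.lift_aux h φ h2 hφ hle).symm

lemma exists_hull (S : NakSetup Λ n P c) : ∀ (B : ℕ), (∀ i, c i ≤ B) → ∀ (k : ℕ) (i : ZMod n), B ≤ c i + k →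
    ∃ m : ZMod n, c (m + 1) ≤ c m ∧ ∃ u : (P i : Type) →ₗ[Λ] (P m : Type), Injective u := by
  intro B hB k
  induction k with
  | zero =>
    intro i hi
    exact ⟨i, by have := hB (i + 1); omega, LinearMap.id, injective_id⟩
  | succ k ih =>
    intro i hi
    by_cases h : c (i + 1) ≤ c i
    · exact ⟨i, h, LinearMap.id, injective_id⟩
    have hc : c (i + 1) = c i + 1 := by have := S.csucc i; omega
    obtain ⟨m, hm, u, hu⟩ := ih (i + 1) (by omega)
    obtain ⟨π, hπ⟩ := S.exπ i
    exact ⟨m, hm, u ∘ₗ π, hu.comp ((S.π_inj_iff i π hπ).mpr hc)⟩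

lemma exists_hull' (S : NakSetup Λ n P c) (i : ZMod n) :
    ∃ m : ZMod n, c (m + 1) ≤ c m ∧ ∃ u : (P i : Type) →ₗ[Λ] (P m : Type), Injective u :=
  S.exists_hull (Finset.univ.sup c) (fun i => Finset.le_sup (Finset.mem_univ i))
    (Finset.univ.sup c) i (by omega)

end NakSetup

namespace NakSetup

variable {Λ : Type} [Ring Λ] {n : ℕ} [NeZero n] {P : ZMod n → ModuleCat.{0} Λ}
    {c : ZMod n → ℕ}

lemma exists_inj_target (S : NakSetup Λ n P c) (a : ZMod n) :
    ∀ Q : ModuleCat.{0} Λ, Module.Finite Λ Q → Module.Projective Λ Q →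
      Module.Injective Λ Q → ∀ φ : (P a : Type) →ₗ[Λ] Q,
        LinearMap.ker φ = radSub Λ (P a : Type) →
        ∃ j : ZMod n, Module.Injective Λ (P j) ∧ ∃ h : (P a : Type) →ₗ[Λ] (P j : Type),
          LinearMap.ker h = radSub Λ (P a : Type) := by
  have := S.art
  apply proj_induction
  · intro Q hQ _ φ hφ
    exfalso
    apply (S.radCoatom a).1
    rw [← hφ, eq_top_iff]
    intro x _
    exact Subsingleton.elim _ _
  · intro Q hf hp hi hinj φ hφ
    obtain ⟨l, ⟨e⟩⟩ := S.all Q hf hp hi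
    refine ⟨l, inj_of_summand e.symm.toLinearMap e.toLinearMap (fun x => by simp) hinj,
      e.toLinearMap ∘ₗ φ, ?_⟩
    rw [LinearMap.ker_comp, LinearEquiv.ker]
    exact hφ
  · intro Q A B e hA hB hinj φ hφ
    have hAi : Module.Injective Λ A := inj_of_summand
      (e.symm.toLinearMap ∘ₗ LinearMap.inl Λ A B) (LinearMap.fst Λ A B ∘ₗ e.toLinearMap)
      (fun x => by simp) hinj
    have hBi : Module.Injective Λ B := inj_of_summand
      (e.symm.toLinearMap ∘ₗ LinearMap.inr Λ A B) (LinearMap.snd Λ A B ∘ₗ e.toLinearMap)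
      (fun x => by simp) hinj
    let α : (P a : Type) →ₗ[Λ] A := LinearMap.fst Λ A B ∘ₗ e.toLinearMap ∘ₗ φ
    let β : (P a : Type) →ₗ[Λ] B := LinearMap.snd Λ A B ∘ₗ e.toLinearMap ∘ₗ φ
    have hα : radSub Λ (P a : Type) ≤ LinearMap.ker α := by
      rw [← hφ]
      intro x hx
      have : φ x = 0 := hx
      simp [α, this]
    have hβ : radSub Λ (P a : Type) ≤ LinearMap.ker β := by
      rw [← hφ]
      intro x hx
      have : φ x = 0 := hx
      simp [β, this]
    by_cases h1 : LinearMap.ker α = ⊤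
    · by_cases h2 : LinearMap.ker β = ⊤
      · exfalso
        apply (S.radCoatom a).1
        rw [← hφ, eq_top_iff]
        intro x _
        have e1 : α x = 0 := by rw [LinearMap.ker_eq_top.mp h1]; rfl
        have e2 : β x = 0 := by rw [LinearMap.ker_eq_top.mp h2]; rfl
        have : e (φ x) = 0 := Prod.ext e1 e2
        exact (LinearEquiv.map_eq_zero_iff e).mp this
      · exact hB hBi β (le_antisymm (S.le_rad a _ h2) hβ)
    · exact hA hAi α (le_antisymm (S.le_rad a _ h1) hα)

lemma forward (S : NakSetup Λ n P c) (hD : DomdimGE2 Λ) (i : ZMod n) (hi : c (i + 1) = c i + 1) :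
    ∃ j : ZMod n, c (j + 1) ≤ c j ∧ i = j - (c j : ZMod n) := by
  obtain ⟨Q0, Q1, f, g, hf0, ⟨hp0, hi0⟩, hf1, ⟨hp1, hi1⟩, hf, hfg⟩ := hD
  obtain ⟨x, -, hx⟩ := SetLike.exists_of_lt (S.radCoatom i).lt_top
  have hps : Surjective (LinearMap.toSpanSingleton Λ (P i : Type) x) := by
    rw [← LinearMap.range_eq_top]
    apply S.eq_top_of
    intro h
    exact hx (h ⟨1, by simp⟩)
  have := S.proj i
  obtain ⟨s, hs⟩ := Module.projective_lifting_property _ LinearMap.id hps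
  set p := LinearMap.toSpanSingleton Λ (P i : Type) x
  have hs' : ∀ y, p (s y) = y := fun y => LinearMap.congr_fun hs y
  obtain ⟨h, hh⟩ := hi0.out f hf (f ∘ₗ (LinearMap.id - s ∘ₗ p))
  obtain ⟨π, hπ⟩ := S.exπ i
  have hπi := (S.π_inj_iff i π hπ).mpr hi
  have hsi : Injective s := LeftInverse.injective hs'
  obtain ⟨F, hF⟩ := hi0.out π hπi (f ∘ₗ s)
  have hfg0 : ∀ y, g (f y) = 0 := fun y => by
    have : f y ∈ LinearMap.ker g := hfg ▸ ⟨y, rfl⟩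
    exact this
  have hFi : LinearMap.ker F = ⊥ := by
    rcases S.uni (i + 1) (LinearMap.ker F) (LinearMap.range π) with hle | hle
    · rw [eq_bot_iff]
      intro y hy
      obtain ⟨z, rfl⟩ := hle hy
      have h1 : F (π z) = 0 := hy
      rw [hF] at h1
      have h2 : z = 0 := hsi (hf (by simpa using h1))
      simp [h2]
    · exfalso
      obtain ⟨z, hz⟩ := (S.ind i).1
      have h1 : F (π z) = 0 := hle ⟨z, rfl⟩
      rw [hF] at h1
      exact hz (hsi (hf (by simpa using h1)))
  have hFinj := LinearMap.ker_eq_bot.mp hFi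
  let φ : (P (i + 1) : Type) →ₗ[Λ] Prod (Q1 : Type) (Q0 : Type) := (g.prod h) ∘ₗ F
  have hφ : LinearMap.ker φ = radSub Λ (P (i + 1) : Type) := by
    rw [← hπ]
    apply le_antisymm
    · intro y hy
      have hy' : φ y = 0 := hy
      have h1 : g (F y) = 0 := congrArg Prod.fst hy'
      have h2 : h (F y) = 0 := congrArg Prod.snd hy'
      have h3 : F y ∈ LinearMap.range f := hfg ▸ h1
      obtain ⟨z, hz⟩ := h3
      rw [← hz, hh] at h2
      have h4 : z - s (p z) = 0 := hf (by simpa using h2)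
      rw [sub_eq_zero] at h4
      refine ⟨p z, hFinj ?_⟩
      rw [hF, ← hz]
      simp only [LinearMap.comp_apply]
      rw [← h4]
    · rintro _ ⟨z, rfl⟩
      have h1 : φ (π z) = (g (F (π z)), h (F (π z))) := rfl
      rw [LinearMap.mem_ker, h1, hF]
      simp [hfg0, hh, hs']
  obtain ⟨j, hj, ψ, hψ⟩ := S.exists_inj_target (i + 1)
    (ModuleCat.of Λ (Prod (Q1 : Type) (Q0 : Type)))
    (inferInstanceAs (Module.Finite Λ (Prod (Q1 : Type) (Q0 : Type))))
    (inferInstanceAs (Module.Projective Λ (Prod (Q1 : Type) (Q0 : Type))))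
    (inj_prod hi1 hi0) φ hφ
  obtain ⟨a, ha, u, hu⟩ := S.exists_socle j
  have hia := S.socle_unique ψ u hψ hu
  refine ⟨j, S.le_of_injective j hj, ?_⟩
  rw [← hia] at ha
  linear_combination ha

lemma backward_one (S : NakSetup Λ n P c) (H : ∀ i : ZMod n, c (i + 1) = c i + 1 →
      ∃ j : ZMod n, c (j + 1) ≤ c j ∧ i = j - (c j : ZMod n)) (i : ZMod n) :
    ∃ (m j : ZMod n) (f : (P i : Type) →ₗ[Λ] (P m : Type))
      (g : (P m : Type) →ₗ[Λ] (P j : Type)),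
      Module.Injective Λ (P m) ∧ Module.Injective Λ (P j) ∧ Injective f ∧
      LinearMap.range f = LinearMap.ker g := by
  by_cases hi : c (i + 1) ≤ c i
  · have hI := S.injective_of_le i hi
    refine ⟨i, i, LinearMap.id, 0, hI, hI, injective_id, ?_⟩
    rw [LinearMap.range_id, LinearMap.ker_zero]
  have hc : c (i + 1) = c i + 1 := by have := S.csucc i; omega
  obtain ⟨j, hj, hij⟩ := H i hc
  obtain ⟨m, hm, u, hu⟩ := S.exists_hull' (i + 1)
  obtain ⟨π, hπ⟩ := S.exπ i
  have hπi := (S.π_inj_iff i π hπ).mpr hc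
  obtain ⟨a, ha, h, hh⟩ := S.exists_socle j
  obtain rfl : a = i + 1 := by rw [hij]; linear_combination ha
  have hIj := S.injective_of_le j hj
  obtain ⟨g, hg⟩ := hIj.out u hu h
  refine ⟨m, j, u ∘ₗ π, g, S.injective_of_le m hm, hIj, hu.comp hπi, ?_⟩
  apply le_antisymm
  · rintro _ ⟨z, rfl⟩
    have : π z ∈ LinearMap.ker h := by rw [hh, ← hπ]; exact ⟨z, rfl⟩
    rw [LinearMap.mem_ker, LinearMap.comp_apply, hg]
    exact this
  · rcases S.uni m (LinearMap.ker g) (LinearMap.range u) with hle | hle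
    · intro y hy
      obtain ⟨z, rfl⟩ := hle hy
      have h1 : z ∈ LinearMap.ker h := by
        rw [LinearMap.mem_ker, ← hg]; exact hy
      rw [hh, ← hπ] at h1
      obtain ⟨w, rfl⟩ := h1
      exact ⟨w, rfl⟩
    · exfalso
      apply (S.radCoatom (i + 1)).1
      rw [← hh, eq_top_iff]
      intro z _
      rw [LinearMap.mem_ker, ← hg]
      exact hle ⟨z, rfl⟩

lemma backward (S : NakSetup Λ n P c) (H : ∀ i : ZMod n, c (i + 1) = c i + 1 →
      ∃ j : ZMod n, c (j + 1) ≤ c j ∧ i = j - (c j : ZMod n)) : DomdimGE2 Λ := by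
  have := S.art
  refine proj_induction (fun Q => ∃ (Q0 Q1 : ModuleCat.{0} Λ) (f : Q →ₗ[Λ] Q0)
    (g : Q0 →ₗ[Λ] Q1), Module.Finite Λ Q0 ∧ IsProjInj Λ Q0 ∧ Module.Finite Λ Q1 ∧
    IsProjInj Λ Q1 ∧ Injective f ∧ LinearMap.range f = LinearMap.ker g) ?_ ?_ ?_
    (ModuleCat.of Λ Λ) (inferInstanceAs (Module.Finite Λ Λ))
    (inferInstanceAs (Module.Projective Λ Λ))
  · intro Q hQ
    have hp : Module.Projective Λ Q :=
      Module.Projective.of_split (0 : (Q : Type) →ₗ[Λ] Λ) 0 (by ext x; exact Subsingleton.elim _ _)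
    have hi : Module.Injective Λ Q :=
      ⟨fun X Y _ _ _ _ f hf g => ⟨0, fun x => Subsingleton.elim _ _⟩⟩
    have hf : Module.Finite Λ Q := inferInstance
    refine ⟨Q, Q, LinearMap.id, 0, hf, ⟨hp, hi⟩, hf, ⟨hp, hi⟩, injective_id, ?_⟩
    rw [LinearMap.range_id, LinearMap.ker_zero]
  · intro Q hf hp hi
    obtain ⟨l, ⟨e⟩⟩ := S.all Q hf hp hi
    obtain ⟨m, j, f, g, hm, hj, hfi, hfg⟩ := S.backward_one H l
    refine ⟨P m, P j, f ∘ₗ e.toLinearMap, g, S.fg m, ⟨S.proj m, hm⟩, S.fg j, ⟨S.proj j, hj⟩,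
      hfi.comp e.injective, ?_⟩
    rw [LinearMap.range_comp, LinearEquiv.range, Submodule.map_top, hfg]
  · rintro Q A B e ⟨A0, A1, fA, gA, a1, ⟨a2, a3⟩, a4, ⟨a5, a6⟩, a7, a8⟩
      ⟨B0, B1, fB, gB, b1, ⟨b2, b3⟩, b4, ⟨b5, b6⟩, b7, b8⟩
    refine ⟨ModuleCat.of Λ (Prod (A0 : Type) (B0 : Type)),
      ModuleCat.of Λ (Prod (A1 : Type) (B1 : Type)),
      (fA.prodMap fB) ∘ₗ e.toLinearMap, gA.prodMap gB,
      inferInstanceAs (Module.Finite Λ (Prod (A0 : Type) (B0 : Type))),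
      ⟨inferInstanceAs (Module.Projective Λ (Prod (A0 : Type) (B0 : Type))), inj_prod a3 b3⟩,
      inferInstanceAs (Module.Finite Λ (Prod (A1 : Type) (B1 : Type))),
      ⟨inferInstanceAs (Module.Projective Λ (Prod (A1 : Type) (B1 : Type))), inj_prod a6 b6⟩,
      (Injective.prodMap a7 b7).comp e.injective, ?_⟩
    rw [LinearMap.range_comp, LinearEquiv.range, Submodule.map_top]
    erw [LinearMap.range_prodMap, LinearMap.ker_prodMap]
    rw [a8, b8]

end NakSetup

theorem stmt19 (Λ : Type) [Ring Λ] (k : Type) [CommRing k] [IsArtinianRing k] [Algebra k Λ]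
    [Module.Finite k Λ]
    (n : ℕ) [NeZero n]
    (P : ZMod n → ModuleCat.{0} Λ)
    (hfg : ∀ i, Module.Finite Λ (P i)) (hproj : ∀ i, Module.Projective Λ (P i))
    (hind : ∀ i, Indecomposable Λ (P i))
    (hne : ∀ i j, i ≠ j → IsEmpty ((P i : Type) ≃ₗ[Λ] (P j : Type)))
    (hall : ∀ M : ModuleCat.{0} Λ, Module.Finite Λ M → Module.Projective Λ M →
      Indecomposable Λ M → ∃ i, Nonempty ((M : Type) ≃ₗ[Λ] (P i : Type)))
    (hNak : ∀ M : ModuleCat.{0} Λ, Module.Finite Λ M → Indecomposable Λ M → Uniserial Λ M)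
    (c : ZMod n → ℕ)
    (hlen : ∀ i, ∃ s : CompositionSeries (Submodule Λ (P i : Type)),
      s.head = ⊥ ∧ s.last = ⊤ ∧ s.length = c i)
    (hc2 : ∀ i, 2 ≤ c i) (hcsucc : ∀ i, c (i + 1) ≤ c i + 1)
    (hKup : ∀ i, ∃ f : (P i : Type) →ₗ[Λ] ↥(radSub Λ (P (i + 1) : Type)),
      IsProjCover Λ f) :
    DomdimGE2 Λ ↔ ∀ i : ZMod n, c (i + 1) = c i + 1 →
      ∃ j : ZMod n, c (j + 1) ≤ c j ∧ i = j - (c j : ZMod n) := by 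
  have S : NakSetup Λ n P c :=
    { art := IsArtinianRing.of_finite k Λ
      fg := hfg
      proj := hproj
      ind := hind
      iso := fun i j ⟨e⟩ => by
        by_contra h
        exact (hne i j h).false e
      all := hall
      nak := hNak
      len := fun i => by
        obtain ⟨s, h1, h2, h3⟩ := hlen i
        rw [← h3, Module.length_compositionSeries s h1 h2]
      c2 := hc2
      csucc := hcsucc
      exπ := fun i => by
        obtain ⟨f, -, hs, -⟩ := hKup i
        refine ⟨(radSub Λ (P (i + 1) : Type)).subtype ∘ₗ f, ?_⟩
        rw [LinearMap.range_comp, LinearMap.range_eq_top.mpr hs, Submodule.map_top,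
          Submodule.range_subtype] }
  exact ⟨fun hD i hi => S.forward hD i hi, S.backward⟩
end
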